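/- Let 𝓜 ⊆ 𝒲 be a set of periodic waves such that τ(𝓜) is a connected subset of C([0, L], ℝ⁷), such that 𝓜 contains at least one trivial wave, and such that every wave in 𝓜 satisfies g − γ(0)·u(L, η(L)) > 0. Then every nontrivial wave in 𝓜 satisfies u_x < 0 at every point of Ω⁺ ∪ S⁺, and moreover |v/u| < σ at every point of the closure of Ω, where σ ≥ 0 is defined by σ² = max over the closure of Ω of (g − γ(ψ)u)/(g + γ(ψ)u). In particular σ² < 1 if γ(0) < 0. -/

import Mathlib

open Set

/-- Partial derivative in the horizontal direction. -/
noncomputable def pdX (f : ℝ × ℝ → ℝ) (p : ℝ × ℝ) : ℝ := fderiv ℝ f p (1, 0)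

/-- Partial derivative in the vertical direction. -/
noncomputable def pdY (f : ℝ × ℝ → ℝ) (p : ℝ × ℝ) : ℝ := fderiv ℝ f p (0, 1)

/-- A symmetric `2L`-periodic steady gravity water wave with vorticity, in the frame
moving with the wave.  The fluid occupies `Ω = {(x,y) : -L < x < L, -d < y < η x}`;
`u, v` are the relative velocity components, `P` is the pressure, `η` the surface
profile, `ψ` the stream function and `γ` the vorticity function. -/
structure PeriodicWave (g Patm L : ℝ) : Type where
  u : ℝ × ℝ → ℝ
  v : ℝ × ℝ → ℝ
  P : ℝ × ℝ → ℝ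
  η : ℝ → ℝ
  ψ : ℝ × ℝ → ℝ
  γ : ℝ → ℝ
  d : ℝ
  m : ℝ
  d_pos : 0 < d
  m_pos : 0 < m
  u_smooth : ContDiff ℝ 3 u
  v_smooth : ContDiff ℝ 3 v
  P_smooth : ContDiff ℝ 3 P
  η_smooth : ContDiff ℝ 4 η
  ψ_smooth : ContDiff ℝ 4 ψ
  γ_smooth : ContDiffOn ℝ 2 γ (Icc 0 m)
  u_periodic : ∀ x y, u (x + 2 * L, y) = u (x, y)
  v_periodic : ∀ x y, v (x + 2 * L, y) = v (x, y)
  P_periodic : ∀ x y, P (x + 2 * L, y) = P (x, y)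
  η_periodic : ∀ x, η (x + 2 * L) = η x
  η_mean : (∫ x in (-L)..L, η x) = 0
  u_even : ∀ x y, u (-x, y) = u (x, y)
  v_odd : ∀ x y, v (-x, y) = -v (x, y)
  P_even : ∀ x y, P (-x, y) = P (x, y)
  η_even : ∀ x, η (-x) = η x
  euler_x : ∀ x y, -d < y → y < η x →
    u (x, y) * pdX u (x, y) + v (x, y) * pdY u (x, y) = -pdX P (x, y)
  euler_y : ∀ x y, -d < y → y < η x →
    u (x, y) * pdX v (x, y) + v (x, y) * pdY v (x, y) = -(pdY P (x, y)) - g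
  incompressible : ∀ x y, -d < y → y < η x → pdX u (x, y) + pdY v (x, y) = 0
  surface_pressure : ∀ x, P (x, η x) = Patm
  surface_kinematic : ∀ x, v (x, η x) = deriv η x * u (x, η x)
  bed_kinematic : ∀ x, v (x, -d) = 0
  nonstagnant : ∃ δ > 0, ∀ x y, -d ≤ y → y ≤ η x → u (x, y) ≤ -δ
  psi_x : ∀ x y, -d ≤ y → y ≤ η x → pdX ψ (x, y) = -v (x, y)
  psi_y : ∀ x y, -d ≤ y → y ≤ η x → pdY ψ (x, y) = u (x, y)
  psi_surface : ∀ x, ψ (x, η x) = 0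
  psi_bed : ∀ x, ψ (x, -d) = m
  vorticity_eq : ∀ x y, -d < y → y < η x → pdX v (x, y) - pdY u (x, y) = γ (ψ (x, y))

namespace PeriodicWave

variable {g Patm L : ℝ}

/-- The closure of one period `Ω` of the fluid domain. -/
def Ωbar (W : PeriodicWave g Patm L) : Set (ℝ × ℝ) :=
  {p | -L ≤ p.1 ∧ p.1 ≤ L ∧ -W.d ≤ p.2 ∧ p.2 ≤ W.η p.1}

/-- The open half period `Ω⁺` of the fluid domain. -/
def Ωplus (W : PeriodicWave g Patm L) : Set (ℝ × ℝ) :=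
  {p | 0 < p.1 ∧ p.1 < L ∧ -W.d < p.2 ∧ p.2 < W.η p.1}

/-- The half period `S⁺` of the free surface. -/
def Splus (W : PeriodicWave g Patm L) : Set (ℝ × ℝ) :=
  {p | 0 < p.1 ∧ p.1 < L ∧ p.2 = W.η p.1}

/-- A wave is trivial if `u, v, P, η` depend only on `y`. -/
def IsTrivial (W : PeriodicWave g Patm L) : Prop :=
  (∀ p, W.v p = 0) ∧ (∀ x, W.η x = 0) ∧
    (∀ x x' y, W.u (x, y) = W.u (x', y)) ∧ (∀ x x' y, W.P (x, y) = W.P (x', y))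

/-- The streamline monotonicity condition `v > 0` on `Ω⁺ ∪ S⁺`. -/
def MonotoneHalf (W : PeriodicWave g Patm L) : Prop :=
  ∀ p ∈ W.Ωplus ∪ W.Splus, 0 < W.v p

/-- Membership in the water-wave set 𝒲 : the vorticity function satisfies
`γ ≤ 0`, `γ' ≤ 0`, `γ'' ≤ 0` on `[0, m]`, and the wave is either trivial or
monotone. -/
def MemW (W : PeriodicWave g Patm L) : Prop :=
  (∀ s ∈ Icc (0:ℝ) W.m, W.γ s ≤ 0) ∧
  (∀ s ∈ Icc (0:ℝ) W.m, derivWithin W.γ (Icc 0 W.m) s ≤ 0) ∧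
  (∀ s ∈ Icc (0:ℝ) W.m, derivWithin (derivWithin W.γ (Icc 0 W.m)) (Icc 0 W.m) s ≤ 0) ∧
  (W.IsTrivial ∨ W.MonotoneHalf)

/-- The trace of `(u, v, u_x, v_x, u_y, u_xx, u_xy)` on the free surface. -/
noncomputable def trace (W : PeriodicWave g Patm L) (x : ℝ) :
    ℝ × ℝ × ℝ × ℝ × ℝ × ℝ × ℝ :=
  (W.u (x, W.η x), W.v (x, W.η x), pdX W.u (x, W.η x), pdX W.v (x, W.η x),
    pdY W.u (x, W.η x), pdX (pdX W.u) (x, W.η x), pdY (pdX W.u) (x, W.η x))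

end PeriodicWave

section Calculus

open Filter Topology

lemma ContDiff.pdX {n : ℕ} {f : ℝ × ℝ → ℝ} (hf : ContDiff ℝ (n + 1) f) :
    ContDiff ℝ n (pdX f) :=
  (hf.fderiv_right le_rfl).clm_apply contDiff_const

lemma ContDiff.pdY {n : ℕ} {f : ℝ × ℝ → ℝ} (hf : ContDiff ℝ (n + 1) f) :
    ContDiff ℝ n (pdY f) :=
  (hf.fderiv_right le_rfl).clm_apply contDiff_const

lemma ContDiff.differentiable_two {f : ℝ × ℝ → ℝ} (hf : ContDiff ℝ 2 f) : Differentiable ℝ f :=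
  hf.differentiable (by norm_num)

lemma hasDerivAt_comp_graph {f : ℝ × ℝ → ℝ} (hf : Differentiable ℝ f) {h : ℝ → ℝ} {h' x : ℝ}
    (hh : HasDerivAt h h' x) :
    HasDerivAt (fun t => f (t, h t)) (pdX f (x, h x) + h' * pdY f (x, h x)) x := by
  have h2 := (hf (x, h x)).hasFDerivAt.comp_hasDerivAt x ((hasDerivAt_id x).prodMk hh)
  have e : fderiv ℝ f (x, h x) (1, h') = pdX f (x, h x) + h' * pdY f (x, h x) := by
    have : ((1 : ℝ), h') = (1, 0) + h' • (0, 1) := by simp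
    rw [this, map_add, map_smul]
    rfl
  rw [← e]
  exact h2

lemma hasDerivAt_pdX {f : ℝ × ℝ → ℝ} (hf : Differentiable ℝ f) (x y : ℝ) :
    HasDerivAt (fun t => f (t, y)) (pdX f (x, y)) x := by
  simpa using hasDerivAt_comp_graph hf (hasDerivAt_const x y)

lemma hasDerivAt_pdY {f : ℝ × ℝ → ℝ} (hf : Differentiable ℝ f) (x y : ℝ) :
    HasDerivAt (fun t => f (x, t)) (pdY f (x, y)) y :=
  (hf (x, y)).hasFDerivAt.comp_hasDerivAt y ((hasDerivAt_const y x).prodMk (hasDerivAt_id y))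

lemma pdX_pdY_comm {f : ℝ × ℝ → ℝ} (hf : ContDiff ℝ 2 f) : pdX (pdY f) = pdY (pdX f) := by
  funext p
  have hd : DifferentiableAt ℝ (fderiv ℝ f) p :=
    ((hf.fderiv_right (m := 1) (by norm_num)).differentiable (by norm_num)) p
  have hs : IsSymmSndFDerivAt ℝ f p := hf.contDiffAt.isSymmSndFDerivAt (by simp)
  have key : ∀ a b : ℝ × ℝ, fderiv ℝ (fun q => fderiv ℝ f q a) p b =
      fderiv ℝ (fderiv ℝ f) p b a := by
    intro a b
    rw [fderiv_clm_apply hd (differentiableAt_const a)]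
    simp
  change fderiv ℝ (fun q => fderiv ℝ f q (0, 1)) p (1, 0)
    = fderiv ℝ (fun q => fderiv ℝ f q (1, 0)) p (0, 1)
  rw [key, key]
  exact hs _ _

/-- The second derivative is nonpositive at a local maximum. -/
lemma IsLocalMax.second_deriv_nonpos {f f' : ℝ → ℝ} {f'' x : ℝ}
    (hmax : IsLocalMax f x) (hf : ∀ t, HasDerivAt f (f' t) t) (hf' : HasDerivAt f' f'' x) :
    f'' ≤ 0 := by
  by_contra! hpos
  have e : deriv f = f' := funext fun t => (hf t).deriv
  have hmin : IsLocalMin f x := by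
    apply isLocalMin_of_deriv_deriv_pos
    · rw [e, hf'.deriv]; exact hpos
    · exact hmax.deriv_eq_zero
    · exact (hf x).continuousAt
  have hc : f =ᶠ[𝓝 x] fun _ => f x := by
    filter_upwards [hmax, hmin] with t h1 h2 using le_antisymm h1 h2
  have h1 : f' =ᶠ[𝓝 x] fun _ => 0 := by
    filter_upwards [hc.eventuallyEq_nhds] with t ht
    rw [← (hf t).deriv, ht.deriv_eq, deriv_const]
  have := h1.deriv_eq
  rw [hf'.deriv, deriv_const] at this
  linarith

lemma HasDerivAt.nonneg_of_eventually_left_le {f : ℝ → ℝ} {f' x : ℝ} (hf : HasDerivAt f f' x)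
    (h : ∀ᶠ t in 𝓝[<] x, f t ≤ f x) : 0 ≤ f' := by
  have h1 := (hasDerivWithinAt_iff_tendsto_slope' (self_notMem_Iio)).1
    (hf.hasDerivWithinAt (s := Iio x))
  refine ge_of_tendsto h1 ?_
  filter_upwards [h, self_mem_nhdsWithin] with t ht htx
  rw [slope_def_field]
  exact div_nonneg_of_nonpos (by linarith) (by linarith [mem_Iio.1 htx])

lemma HasDerivAt.nonneg_of_eventually_right_ge {f : ℝ → ℝ} {f' x : ℝ} (hf : HasDerivAt f f' x)
    (h : ∀ᶠ t in 𝓝[>] x, f x ≤ f t) : 0 ≤ f' := by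
  have h1 := (hasDerivWithinAt_iff_tendsto_slope' (self_notMem_Ioi)).1
    (hf.hasDerivWithinAt (s := Ioi x))
  refine ge_of_tendsto h1 ?_
  filter_upwards [h, self_mem_nhdsWithin] with t ht htx
  rw [slope_def_field]
  exact div_nonneg (by linarith) (by linarith [mem_Ioi.1 htx])

lemma isCompact_subgraph {h : ℝ → ℝ} (hh : Continuous h) (a b c : ℝ) :
    IsCompact {p : ℝ × ℝ | a ≤ p.1 ∧ p.1 ≤ b ∧ c ≤ p.2 ∧ p.2 ≤ h p.1} := by
  obtain ⟨B, hB⟩ := (isCompact_Icc (a := a) (b := b)).bddAbove_image hh.continuousOn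
  refine ((isCompact_Icc (a := a) (b := b)).prod
    (isCompact_Icc (a := c) (b := B))).of_isClosed_subset ?_ ?_
  · refine (isClosed_le continuous_const continuous_fst).inter
      ((isClosed_le continuous_fst continuous_const).inter
        ((isClosed_le continuous_const continuous_snd).inter
          (isClosed_le continuous_snd (hh.comp continuous_fst))))
  · rintro p ⟨h1, h2, h3, h4⟩
    exact ⟨⟨h1, h2⟩, h3, h4.trans (hB ⟨p.1, ⟨h1, h2⟩, rfl⟩)⟩

/-- Weak maximum principle below a graph: a function which is nonpositive on the boundary and
subharmonic wherever it is positive is nonpositive. -/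
lemma nonpos_of_subharmonic_of_pos {h : ℝ → ℝ} (hh : Continuous h) {a b c : ℝ}
    {f : ℝ × ℝ → ℝ} (hf : ContDiff ℝ 2 f)
    (hside : ∀ x y, a ≤ x → x ≤ b → c ≤ y → y ≤ h x → (x = a ∨ x = b ∨ y = c ∨ y = h x) →
      f (x, y) ≤ 0)
    (hsub : ∀ x y, a < x → x < b → c < y → y < h x → 0 < f (x, y) →
      0 ≤ pdX (pdX f) (x, y) + pdY (pdY f) (x, y)) :
    ∀ x y, a ≤ x → x ≤ b → c ≤ y → y ≤ h x → f (x, y) ≤ 0 := by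
  intro x₀ y₀ h1 h2 h3 h4
  by_contra! hpos
  set K := {p : ℝ × ℝ | a ≤ p.1 ∧ p.1 ≤ b ∧ c ≤ p.2 ∧ p.2 ≤ h p.1}
  have hK : IsCompact K := isCompact_subgraph hh a b c
  obtain ⟨B, hB⟩ := hK.bddAbove_image (f := fun p : ℝ × ℝ => p.1 ^ 2) (by fun_prop)
  have hB' : ∀ p ∈ K, p.1 ^ 2 ≤ B := fun p hp => hB ⟨p, hp, rfl⟩
  have hp0 : (x₀, y₀) ∈ K := ⟨h1, h2, h3, h4⟩
  have hB0 : 0 ≤ B := (sq_nonneg _).trans (hB' _ hp0)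
  set ε := f (x₀, y₀) / (B + 1)
  have hε : 0 < ε := by positivity
  have hεB : ε * B < f (x₀, y₀) := by
    have : ε * (B + 1) = f (x₀, y₀) := by simp only [ε]; field_simp
    nlinarith
  obtain ⟨⟨x, y⟩, hpK, hmax⟩ := hK.exists_isMaxOn ⟨_, hp0⟩
    (f := fun p => f p + ε * p.1 ^ 2) (by have := hf.continuous; fun_prop)
  have hfp : 0 < f (x, y) := by
    have e1 : f (x₀, y₀) + ε * x₀ ^ 2 ≤ f (x, y) + ε * x ^ 2 := hmax hp0
    have e2 : x ^ 2 ≤ B := hB' _ hpK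
    have e3 : ε * x ^ 2 ≤ ε * B := by gcongr
    have e4 : 0 ≤ ε * x₀ ^ 2 := by positivity
    linarith
  obtain ⟨k1, k2, k3, k4⟩ := hpK
  simp only at k1 k2 k3 k4
  have hne : ¬ (x = a ∨ x = b ∨ y = c ∨ y = h x) := fun hc =>
    absurd (hside x y k1 k2 k3 k4 hc) (not_le.2 hfp)
  simp only [not_or] at hne
  have l1 := lt_of_le_of_ne k1 (Ne.symm hne.1)
  have l2 := lt_of_le_of_ne k2 hne.2.1
  have l3 := lt_of_le_of_ne k3 (Ne.symm hne.2.2.1)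
  have l4 := lt_of_le_of_ne k4 hne.2.2.2
  have hd : Differentiable ℝ f := hf.differentiable (by norm_num)
  have hdX : Differentiable ℝ (pdX f) :=
    (ContDiff.pdX (n := 1) (by exact_mod_cast hf)).differentiable (by norm_num)
  have hdY : Differentiable ℝ (pdY f) :=
    (ContDiff.pdY (n := 1) (by exact_mod_cast hf)).differentiable (by norm_num)
  have hX : pdX (pdX f) (x, y) + 2 * ε ≤ 0 := by
    refine IsLocalMax.second_deriv_nonpos (f := fun t => f (t, y) + ε * t ^ 2)
      (f' := fun t => pdX f (t, y) + 2 * ε * t) (x := x) ?_ ?_ ?_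
    · have ho : ∀ᶠ t in 𝓝 x, a < t ∧ t < b ∧ y < h t :=
        (eventually_gt_nhds l1).and ((eventually_lt_nhds l2).and
          ((hh.continuousAt).eventually_const_lt l4))
      filter_upwards [ho] with t ht
      exact hmax (show (t, y) ∈ K from ⟨ht.1.le, ht.2.1.le, k3, ht.2.2.le⟩)
    · intro t
      exact ((hasDerivAt_pdX hd t y).fun_add
        (((hasDerivAt_id' t).fun_pow 2).const_mul ε)).congr_deriv (by push_cast; ring)
    · simpa using (hasDerivAt_pdX hdX x y).fun_add ((hasDerivAt_id' x).const_mul (2 * ε))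
  have hY : pdY (pdY f) (x, y) ≤ 0 := by
    refine IsLocalMax.second_deriv_nonpos (f := fun t => f (x, t) + ε * x ^ 2)
      (f' := fun t => pdY f (x, t)) (x := y) ?_ ?_ ?_
    · have ho : ∀ᶠ t in 𝓝 y, c < t ∧ t < h x := (eventually_gt_nhds l3).and (eventually_lt_nhds l4)
      filter_upwards [ho] with t ht
      exact hmax (show (x, t) ∈ K from ⟨k1, k2, ht.1.le, ht.2.le⟩)
    · intro t
      exact (hasDerivAt_pdY hd x t).add_const _
    · exact hasDerivAt_pdY hdY x y
  linarith [hsub x y l1 l2 l3 l4 hfp]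

end Calculus

namespace PeriodicWave

open Filter Topology

variable {g Patm L : ℝ} (W : PeriodicWave g Patm L)

/-- The open fluid domain, over all horizontal periods. -/
def fluid : Set (ℝ × ℝ) := {p | -W.d < p.2 ∧ p.2 < W.η p.1}

/-- The closed fluid domain, over all horizontal periods. -/
def fluidBar : Set (ℝ × ℝ) := {p | -W.d ≤ p.2 ∧ p.2 ≤ W.η p.1}

/-- The derivative of the vorticity function. -/
noncomputable def γ₁ : ℝ → ℝ := derivWithin W.γ (Icc 0 W.m)

/-- The second derivative of the vorticity function. -/
noncomputable def γ₂ : ℝ → ℝ := derivWithin W.γ₁ (Icc 0 W.m)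

lemma isOpen_fluid : IsOpen W.fluid :=
  (isOpen_lt continuous_const continuous_snd).inter
    (isOpen_lt continuous_snd (W.η_smooth.continuous.comp continuous_fst))

lemma fluid_subset_fluidBar : W.fluid ⊆ W.fluidBar := fun _ hp => ⟨hp.1.le, hp.2.le⟩

lemma neg_d_lt_η (hL : 0 < L) (x : ℝ) : -W.d < W.η x := by
  have hc := W.η_smooth.continuous
  have hne : ∀ x, W.η x ≠ -W.d := fun x hx => by
    have h1 := W.psi_surface x
    have h2 := W.psi_bed x
    rw [hx] at h1
    linarith [W.m_pos]
  by_contra! hx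
  have hlt : ∀ z, W.η z < -W.d := by
    by_contra! ⟨z, hz⟩
    obtain ⟨t, ht⟩ := mem_range_of_exists_le_of_exists_ge hc ⟨x, hx⟩ ⟨z, hz⟩
    exact hne t ht
  have h3 : (∫ x in (-L)..L, W.η x) ≤ ∫ x in (-L)..L, -W.d :=
    intervalIntegral.integral_mono_on (by linarith) (hc.intervalIntegrable _ _)
      (by simp) (fun z _ => (hlt z).le)
  rw [W.η_mean, intervalIntegral.integral_const, smul_eq_mul] at h3
  nlinarith [W.d_pos]

lemma surface_mem (hL : 0 < L) (x : ℝ) : (x, W.η x) ∈ W.fluidBar := ⟨(W.neg_d_lt_η hL x).le, le_rfl⟩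

lemma fluidBar_subset_closure (hL : 0 < L) : W.fluidBar ⊆ closure W.fluid := by
  rintro ⟨x, y⟩ ⟨h1, h2⟩
  have hy : y ∈ closure (Ioo (-W.d) (W.η x)) := by
    rw [closure_Ioo (W.neg_d_lt_η hL x).ne]
    exact ⟨h1, h2⟩
  exact map_mem_closure (f := fun t => (x, t)) (by fun_prop) hy fun t ht => ht

lemma eqOn_fluidBar (hL : 0 < L) {f h : ℝ × ℝ → ℝ} (hf : ContinuousOn f W.fluidBar)
    (hh : ContinuousOn h W.fluidBar) (heq : EqOn f h W.fluid) : EqOn f h W.fluidBar :=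
  heq.of_subset_closure hf hh W.fluid_subset_fluidBar (W.fluidBar_subset_closure hL)

lemma differentiable_u : Differentiable ℝ W.u := W.u_smooth.differentiable (by norm_num)
lemma differentiable_v : Differentiable ℝ W.v := W.v_smooth.differentiable (by norm_num)
lemma differentiable_P : Differentiable ℝ W.P := W.P_smooth.differentiable (by norm_num)
lemma differentiable_ψ : Differentiable ℝ W.ψ := W.ψ_smooth.differentiable (by norm_num)
lemma differentiable_η : Differentiable ℝ W.η := W.η_smooth.differentiable (by norm_num)

lemma contDiff_ux : ContDiff ℝ 2 (pdX W.u) := W.u_smooth.pdX (n := 2)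
lemma contDiff_uy : ContDiff ℝ 2 (pdY W.u) := W.u_smooth.pdY (n := 2)
lemma contDiff_vx : ContDiff ℝ 2 (pdX W.v) := W.v_smooth.pdX (n := 2)
lemma contDiff_vy : ContDiff ℝ 2 (pdY W.v) := W.v_smooth.pdY (n := 2)
lemma contDiff_Px : ContDiff ℝ 2 (pdX W.P) := W.P_smooth.pdX (n := 2)
lemma contDiff_Py : ContDiff ℝ 2 (pdY W.P) := W.P_smooth.pdY (n := 2)

lemma u_neg {x y : ℝ} (h : (x, y) ∈ W.fluidBar) : W.u (x, y) < 0 := by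
  obtain ⟨δ, hδ, hu⟩ := W.nonstagnant
  linarith [hu x y h.1 h.2]

lemma strictAntiOn_ψ (x : ℝ) : StrictAntiOn (fun y => W.ψ (x, y)) (Icc (-W.d) (W.η x)) := by
  refine strictAntiOn_of_deriv_neg (convex_Icc _ _)
    (W.ψ_smooth.continuous.comp (by fun_prop)).continuousOn fun y hy => ?_
  rw [interior_Icc] at hy
  rw [(hasDerivAt_pdY W.differentiable_ψ x y).deriv, W.psi_y x y hy.1.le hy.2.le]
  exact W.u_neg ⟨hy.1.le, hy.2.le⟩

lemma ψ_mem_Icc {p : ℝ × ℝ} (hp : p ∈ W.fluidBar) : W.ψ p ∈ Icc 0 W.m := by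
  obtain ⟨x, y⟩ := p
  have hle : -W.d ≤ W.η x := hp.1.trans hp.2
  have h1 := (W.strictAntiOn_ψ x).antitoneOn (left_mem_Icc.2 hle) hp hp.1
  have h2 := (W.strictAntiOn_ψ x).antitoneOn hp (right_mem_Icc.2 hle) hp.2
  simp only [W.psi_bed, W.psi_surface] at h1 h2
  exact ⟨h2, h1⟩

lemma ψ_mem_Ioo {p : ℝ × ℝ} (hp : p ∈ W.fluid) : W.ψ p ∈ Ioo 0 W.m := by
  obtain ⟨x, y⟩ := p
  have hle : -W.d ≤ W.η x := (hp.1.trans hp.2).le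
  have hm : y ∈ Icc (-W.d) (W.η x) := ⟨hp.1.le, hp.2.le⟩
  have h1 := (W.strictAntiOn_ψ x) (left_mem_Icc.2 hle) hm hp.1
  have h2 := (W.strictAntiOn_ψ x) hm (right_mem_Icc.2 hle) hp.2
  simp only [W.psi_bed, W.psi_surface] at h1 h2
  exact ⟨h2, h1⟩

lemma contDiffOn_γ₁ : ContDiffOn ℝ 1 W.γ₁ (Icc 0 W.m) :=
  W.γ_smooth.derivWithin (uniqueDiffOn_Icc W.m_pos) (by norm_num)

lemma hasDerivAt_γ {s : ℝ} (hs : s ∈ Ioo 0 W.m) : HasDerivAt W.γ (W.γ₁ s) s :=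
  ((W.γ_smooth.differentiableOn (by norm_num)) s
    (Ioo_subset_Icc_self hs)).hasDerivWithinAt.hasDerivAt (Icc_mem_nhds hs.1 hs.2)

lemma hasDerivAt_γ₁ {s : ℝ} (hs : s ∈ Ioo 0 W.m) : HasDerivAt W.γ₁ (W.γ₂ s) s :=
  ((W.contDiffOn_γ₁.differentiableOn (by norm_num)) s
    (Ioo_subset_Icc_self hs)).hasDerivWithinAt.hasDerivAt (Icc_mem_nhds hs.1 hs.2)

lemma continuousOn_γψ : ContinuousOn (fun p => W.γ (W.ψ p)) W.fluidBar :=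
  W.γ_smooth.continuousOn.comp W.ψ_smooth.continuous.continuousOn fun _ hp => W.ψ_mem_Icc hp

lemma continuousOn_γ₁ψ : ContinuousOn (fun p => W.γ₁ (W.ψ p)) W.fluidBar :=
  W.contDiffOn_γ₁.continuousOn.comp W.ψ_smooth.continuous.continuousOn fun _ hp => W.ψ_mem_Icc hp

/-- Horizontal differentiation of an identity valid in the fluid domain. -/
lemma pdX_congr {f h : ℝ × ℝ → ℝ} (heq : EqOn f h W.fluid) {x y a b : ℝ} (hp : (x, y) ∈ W.fluid)
    (hf : HasDerivAt (fun t => f (t, y)) a x) (hh : HasDerivAt (fun t => h (t, y)) b x) :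
    a = b := by
  refine hf.unique (hh.congr_of_eventuallyEq ?_)
  have : Tendsto (fun t : ℝ => (t, y)) (𝓝 x) (𝓝 (x, y)) := by
    apply Continuous.tendsto; fun_prop
  filter_upwards [this (W.isOpen_fluid.mem_nhds hp)] with t ht using heq ht

/-- Vertical differentiation of an identity valid in the fluid domain. -/
lemma pdY_congr {f h : ℝ × ℝ → ℝ} (heq : EqOn f h W.fluid) {x y a b : ℝ} (hp : (x, y) ∈ W.fluid)
    (hf : HasDerivAt (fun t => f (x, t)) a y) (hh : HasDerivAt (fun t => h (x, t)) b y) :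
    a = b := by
  refine hf.unique (hh.congr_of_eventuallyEq ?_)
  have : Tendsto (fun t : ℝ => (x, t)) (𝓝 y) (𝓝 (x, y)) := by
    apply Continuous.tendsto; fun_prop
  filter_upwards [this (W.isOpen_fluid.mem_nhds hp)] with t ht using heq ht

lemma hasDerivAt_ψ_x {x y : ℝ} (hp : (x, y) ∈ W.fluid) :
    HasDerivAt (fun t => W.ψ (t, y)) (-W.v (x, y)) x := by
  rw [← W.psi_x x y hp.1.le hp.2.le]
  exact hasDerivAt_pdX W.differentiable_ψ x y

lemma hasDerivAt_ψ_y {x y : ℝ} (hp : (x, y) ∈ W.fluid) :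
    HasDerivAt (fun t => W.ψ (x, t)) (W.u (x, y)) y := by
  rw [← W.psi_y x y hp.1.le hp.2.le]
  exact hasDerivAt_pdY W.differentiable_ψ x y

lemma vy_eq (hL : 0 < L) : EqOn (pdY W.v) (fun p => -pdX W.u p) W.fluidBar :=
  W.eqOn_fluidBar hL W.contDiff_vy.continuous.continuousOn
    W.contDiff_ux.continuous.neg.continuousOn fun p hp => by
      have := W.incompressible p.1 p.2 hp.1 hp.2
      simp only [Prod.mk.eta] at this
      linarith

lemma uy_eq (hL : 0 < L) : EqOn (pdY W.u) (fun p => pdX W.v p - W.γ (W.ψ p)) W.fluidBar :=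
  W.eqOn_fluidBar hL W.contDiff_uy.continuous.continuousOn
    (W.contDiff_vx.continuous.continuousOn.sub W.continuousOn_γψ) fun p hp => by
      have := W.vorticity_eq p.1 p.2 hp.1 hp.2
      simp only [Prod.mk.eta] at this
      linarith

lemma vxy_eq_fluid (hL : 0 < L) :
    EqOn (pdX (pdY W.v)) (fun p => -pdX (pdX W.u) p) W.fluid := fun ⟨x, y⟩ hp =>
  W.pdX_congr (fun _ h => W.vy_eq hL (W.fluid_subset_fluidBar h)) hp
    (hasDerivAt_pdX W.contDiff_vy.differentiable_two x y)
    (hasDerivAt_pdX W.contDiff_ux.differentiable_two x y).fun_neg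

lemma vyy_eq_fluid (hL : 0 < L) :
    EqOn (pdY (pdY W.v)) (fun p => -pdY (pdX W.u) p) W.fluid := fun ⟨x, y⟩ hp =>
  W.pdY_congr (fun _ h => W.vy_eq hL (W.fluid_subset_fluidBar h)) hp
    (hasDerivAt_pdY W.contDiff_vy.differentiable_two x y)
    (hasDerivAt_pdY W.contDiff_ux.differentiable_two x y).fun_neg

lemma uxy_eq_fluid (hL : 0 < L) :
    EqOn (pdY (pdX W.u)) (fun p => pdX (pdX W.v) p + W.γ₁ (W.ψ p) * W.v p) W.fluid := by
  rintro ⟨x, y⟩ hp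
  rw [← pdX_pdY_comm (W.u_smooth.of_le (by norm_num))]
  refine W.pdX_congr (fun _ h => W.uy_eq hL (W.fluid_subset_fluidBar h)) hp
    (hasDerivAt_pdX W.contDiff_uy.differentiable_two x y)
    (((hasDerivAt_pdX W.contDiff_vx.differentiable_two x y).fun_sub
      ((W.hasDerivAt_γ (W.ψ_mem_Ioo hp)).comp x (W.hasDerivAt_ψ_x hp))).congr_deriv ?_)
  ring

lemma uyy_eq_fluid (hL : 0 < L) :
    EqOn (pdY (pdY W.u)) (fun p => -pdX (pdX W.u) p - W.γ₁ (W.ψ p) * W.u p) W.fluid := by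
  rintro ⟨x, y⟩ hp
  refine W.pdY_congr (fun _ h => W.uy_eq hL (W.fluid_subset_fluidBar h)) hp
    (hasDerivAt_pdY W.contDiff_uy.differentiable_two x y)
    (((hasDerivAt_pdY W.contDiff_vx.differentiable_two x y).fun_sub
      ((W.hasDerivAt_γ (W.ψ_mem_Ioo hp)).comp y (W.hasDerivAt_ψ_y hp))).congr_deriv ?_)
  rw [← pdX_pdY_comm (W.v_smooth.of_le (by norm_num)), W.vxy_eq_fluid hL hp]

lemma uxy_eq (hL : 0 < L) :
    EqOn (pdY (pdX W.u)) (fun p => pdX (pdX W.v) p + W.γ₁ (W.ψ p) * W.v p) W.fluidBar :=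
  W.eqOn_fluidBar hL (W.contDiff_ux.pdY (n := 1)).continuous.continuousOn
    ((W.contDiff_vx.pdX (n := 1)).continuous.continuousOn.add
      (W.continuousOn_γ₁ψ.mul W.v_smooth.continuous.continuousOn)) (W.uxy_eq_fluid hL)

lemma vxy_eq (hL : 0 < L) :
    EqOn (pdX (pdY W.v)) (fun p => -pdX (pdX W.u) p) W.fluidBar :=
  W.eqOn_fluidBar hL (W.contDiff_vy.pdX (n := 1)).continuous.continuousOn
    (W.contDiff_ux.pdX (n := 1)).continuous.neg.continuousOn (W.vxy_eq_fluid hL)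

lemma laplacian_ux (hL : 0 < L) {x y : ℝ} (hp : (x, y) ∈ W.fluid) :
    pdX (pdX (pdX W.u)) (x, y) + pdY (pdY (pdX W.u)) (x, y) =
      W.γ₂ (W.ψ (x, y)) * W.v (x, y) * W.u (x, y) - W.γ₁ (W.ψ (x, y)) * pdX W.u (x, y) := by
  have e : pdY (pdY (pdX W.u)) = pdX (pdY (pdY W.u)) := by
    rw [← pdX_pdY_comm (W.u_smooth.of_le (by norm_num)), ← pdX_pdY_comm W.contDiff_uy]
  have := W.pdX_congr (W.uyy_eq_fluid hL) hp
    (hasDerivAt_pdX (W.contDiff_uy.pdY (n := 1)).differentiable_one x y)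
    ((hasDerivAt_pdX (W.contDiff_ux.pdX (n := 1)).differentiable_one x y).fun_neg.fun_sub
      (((W.hasDerivAt_γ₁ (W.ψ_mem_Ioo hp)).comp x (W.hasDerivAt_ψ_x hp)).fun_mul
        (hasDerivAt_pdX W.differentiable_u x y)))
  rw [e, this]
  simp only [Function.comp, γ₁]
  ring

lemma uxxy_eq (hL : 0 < L) {x y : ℝ} (hp : (x, y) ∈ W.fluid) :
    pdX (pdY (pdX W.u)) (x, y) = pdX (pdX (pdX W.v)) (x, y)
      - W.γ₂ (W.ψ (x, y)) * W.v (x, y) * W.v (x, y) + W.γ₁ (W.ψ (x, y)) * pdX W.v (x, y) := by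
  have := W.pdX_congr (W.uxy_eq_fluid hL) hp
    (hasDerivAt_pdX (W.contDiff_ux.pdY (n := 1)).differentiable_one x y)
    ((hasDerivAt_pdX (W.contDiff_vx.pdX (n := 1)).differentiable_one x y).fun_add
      (((W.hasDerivAt_γ₁ (W.ψ_mem_Ioo hp)).comp x (W.hasDerivAt_ψ_x hp)).fun_mul
        (hasDerivAt_pdX W.differentiable_v x y)))
  rw [this]
  simp only [Function.comp, γ₁]
  ring

lemma v_zero_left (y : ℝ) : W.v (0, y) = 0 := by
  have := W.v_odd 0 y
  rw [neg_zero] at this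
  linarith

lemma v_zero_right (y : ℝ) : W.v (L, y) = 0 := by
  have h1 := W.v_odd L y
  have h2 := W.v_periodic (-L) y
  rw [show -L + 2 * L = L by ring] at h2
  linarith

lemma ux_odd (x y : ℝ) : pdX W.u (-x, y) = -pdX W.u (x, y) := by
  have h1 : HasDerivAt (fun t => W.u (-t, y)) (pdX W.u (-x, y) * (-1)) x :=
    (hasDerivAt_pdX W.differentiable_u (-x) y).comp x (hasDerivAt_neg x)
  have h2 : (fun t => W.u (-t, y)) = fun t => W.u (t, y) := funext fun t => W.u_even t y
  rw [h2] at h1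
  linarith [h1.unique (hasDerivAt_pdX W.differentiable_u x y)]

lemma vx_even (x y : ℝ) : pdX W.v (-x, y) = pdX W.v (x, y) := by
  have h1 : HasDerivAt (fun t => W.v (-t, y)) (pdX W.v (-x, y) * (-1)) x :=
    (hasDerivAt_pdX W.differentiable_v (-x) y).comp x (hasDerivAt_neg x)
  have h2 : (fun t => W.v (-t, y)) = fun t => -W.v (t, y) := funext fun t => W.v_odd t y
  rw [h2] at h1
  linarith [h1.unique (hasDerivAt_pdX W.differentiable_v x y).fun_neg]

lemma ux_periodic (x y : ℝ) : pdX W.u (x + 2 * L, y) = pdX W.u (x, y) := by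
  have h1 := (hasDerivAt_pdX W.differentiable_u (x + 2 * L) y).comp_add_const x (2 * L)
  have h2 : (fun t => W.u (t + 2 * L, y)) = fun t => W.u (t, y) :=
    funext fun t => W.u_periodic t y
  rw [h2] at h1
  exact h1.unique (hasDerivAt_pdX W.differentiable_u x y)

lemma ux_zero_left (y : ℝ) : pdX W.u (0, y) = 0 := by
  have := W.ux_odd 0 y
  rw [neg_zero] at this
  linarith

lemma ux_zero_right (y : ℝ) : pdX W.u (L, y) = 0 := by
  have h1 := W.ux_odd L y
  have h2 := W.ux_periodic (-L) y
  rw [show -L + 2 * L = L by ring] at h2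
  linarith

lemma hasDerivAt_η (hL : 0 < L) (x : ℝ) :
    HasDerivAt W.η (W.v (x, W.η x) / W.u (x, W.η x)) x := by
  rw [W.surface_kinematic, mul_div_cancel_right₀ _ (W.u_neg (W.surface_mem hL x)).ne]
  exact (W.differentiable_η x).hasDerivAt

lemma euler_x_closed (hL : 0 < L) : EqOn (fun p => W.u p * pdX W.u p + W.v p * pdY W.u p)
    (fun p => -pdX W.P p) W.fluidBar := by
  have h1 := W.u_smooth.continuous
  have h2 := W.v_smooth.continuous
  have h3 := W.contDiff_ux.continuous
  have h4 := W.contDiff_uy.continuous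
  have h5 := W.contDiff_Px.continuous
  exact W.eqOn_fluidBar hL (by fun_prop) (by fun_prop) fun p hp => W.euler_x p.1 p.2 hp.1 hp.2

lemma euler_y_closed (hL : 0 < L) : EqOn (fun p => W.u p * pdX W.v p + W.v p * pdY W.v p)
    (fun p => -pdY W.P p - g) W.fluidBar := by
  have h1 := W.u_smooth.continuous
  have h2 := W.v_smooth.continuous
  have h3 := W.contDiff_vx.continuous
  have h4 := W.contDiff_vy.continuous
  have h5 := W.contDiff_Py.continuous
  exact W.eqOn_fluidBar hL (by fun_prop) (by fun_prop) fun p hp => W.euler_y p.1 p.2 hp.1 hp.2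

lemma pressure_tangential (hL : 0 < L) (x : ℝ) :
    W.u (x, W.η x) * pdX W.P (x, W.η x) + W.v (x, W.η x) * pdY W.P (x, W.η x) = 0 := by
  have h1 := hasDerivAt_comp_graph W.differentiable_P (W.hasDerivAt_η hL x)
  have h2 : (fun t => W.P (t, W.η t)) = fun _ => Patm := funext W.surface_pressure
  rw [h2] at h1
  have h3 := h1.unique (hasDerivAt_const x Patm)
  have h4 := (W.u_neg (W.surface_mem hL x)).ne
  field_simp at h3
  linarith

/-- The tangential derivative of Bernoulli's law on the free surface. -/
lemma bernoulli (hL : 0 < L) (x : ℝ) :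
    (W.u (x, W.η x) ^ 2 - W.v (x, W.η x) ^ 2) * pdX W.u (x, W.η x) + W.v (x, W.η x) *
      (W.u (x, W.η x) * (pdX W.v (x, W.η x) + pdY W.u (x, W.η x)) + g) = 0 := by
  have h1 := W.euler_x_closed hL (W.surface_mem hL x)
  have h2 := W.euler_y_closed hL (W.surface_mem hL x)
  have h3 := W.pressure_tangential hL x
  have h4 := W.vy_eq hL (W.surface_mem hL x)
  simp only at h1 h2 h4
  rw [h4] at h2
  linear_combination W.u (x, W.η x) * h1 + W.v (x, W.η x) * h2 - h3

lemma surface_uy (hL : 0 < L) (x : ℝ) :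
    pdY W.u (x, W.η x) = pdX W.v (x, W.η x) - W.γ 0 := by
  have := W.uy_eq hL (W.surface_mem hL x)
  simpa only [W.psi_surface] using this

end PeriodicWave

section Monotone

open Filter Topology

namespace PeriodicWave

variable {g Patm L : ℝ} (W : PeriodicWave g Patm L)

lemma v_pos_surface (hm : W.MonotoneHalf) {x : ℝ} (hx : x ∈ Ioo 0 L) : 0 < W.v (x, W.η x) :=
  hm _ (Or.inr ⟨hx.1, hx.2, rfl⟩)

lemma v_nonneg (hm : W.MonotoneHalf) {x y : ℝ} (hx : x ∈ Icc 0 L) (hp : (x, y) ∈ W.fluidBar) :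
    0 ≤ W.v (x, y) := by
  rcases hx.1.eq_or_lt with rfl | h1
  · rw [v_zero_left]
  rcases hx.2.eq_or_lt with rfl | h2
  · rw [v_zero_right]
  rcases hp.1.eq_or_lt with h3 | h3
  · rw [← show -W.d = y from h3, W.bed_kinematic]
  rcases hp.2.eq_or_lt with h4 | h4
  · exact (hm _ (Or.inr ⟨h1, h2, h4⟩)).le
  · exact (hm _ (Or.inl ⟨h1, h2, h3, h4⟩)).le

lemma eventually_left_mem_fluid (hL : 0 < L) (x : ℝ) :
    ∀ᶠ t in 𝓝[<] (W.η x), (x, t) ∈ W.fluid := by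
  filter_upwards [Ioo_mem_nhdsLT (W.neg_d_lt_η hL x)] with t ht using ht

lemma eventually_right_mem_fluidBar {y : ℝ} (hL : 0 < L) (h1 : -W.d ≤ y) (h2 : y < W.η 0) :
    ∀ᶠ t in 𝓝[>] 0, t ∈ Icc 0 L ∧ (t, y) ∈ W.fluidBar := by
  filter_upwards [Ioo_mem_nhdsGT hL, nhdsWithin_le_nhds
    (W.η_smooth.continuous.continuousAt.eventually_const_lt h2)] with t ht ht'
  exact ⟨Ioo_subset_Icc_self ht, h1, ht'.le⟩

lemma ux_bed_nonpos (hL : 0 < L) (hm : W.MonotoneHalf) {x : ℝ} (hx : x ∈ Icc 0 L) :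
    pdX W.u (x, -W.d) ≤ 0 := by
  have hd := W.neg_d_lt_η hL x
  have h1 : 0 ≤ pdY W.v (x, -W.d) := by
    refine (hasDerivAt_pdY W.differentiable_v x (-W.d)).nonneg_of_eventually_right_ge ?_
    filter_upwards [Ioo_mem_nhdsGT hd] with t ht
    rw [W.bed_kinematic]
    exact W.v_nonneg hm hx ⟨ht.1.le, ht.2.le⟩
  have h2 := W.vy_eq hL (show (x, -W.d) ∈ W.fluidBar from ⟨le_rfl, hd.le⟩)
  simp only at h2
  linarith

lemma laplacian_ux_ge (hL : 0 < L) (h2 : ∀ s ∈ Icc 0 W.m, W.γ₂ s ≤ 0) (hm : W.MonotoneHalf)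
    {x y : ℝ} (hx : x ∈ Icc 0 L) (hp : (x, y) ∈ W.fluid) :
    -W.γ₁ (W.ψ (x, y)) * pdX W.u (x, y) ≤
      pdX (pdX (pdX W.u)) (x, y) + pdY (pdY (pdX W.u)) (x, y) := by
  have hp' := W.fluid_subset_fluidBar hp
  have k1 := W.v_nonneg hm hx hp'
  have k2 := h2 _ (W.ψ_mem_Icc hp')
  have k3 := mul_nonneg_of_nonpos_of_nonpos (mul_nonpos_of_nonpos_of_nonneg k2 k1) (W.u_neg hp').le
  rw [W.laplacian_ux hL hp]
  linarith

lemma ux_nonpos (hL : 0 < L) (h1 : ∀ s ∈ Icc 0 W.m, W.γ₁ s ≤ 0)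
    (h2 : ∀ s ∈ Icc 0 W.m, W.γ₂ s ≤ 0) (hm : W.MonotoneHalf)
    (hux : ∀ x ∈ Icc 0 L, pdX W.u (x, W.η x) ≤ 0)
    {x y : ℝ} (hx : x ∈ Icc 0 L) (hp : (x, y) ∈ W.fluidBar) : pdX W.u (x, y) ≤ 0 := by
  refine nonpos_of_subharmonic_of_pos W.η_smooth.continuous (a := 0) (b := L) (c := -W.d)
    W.contDiff_ux ?_ ?_ x y hx.1 hx.2 hp.1 hp.2
  · rintro x y k1 k2 - - (rfl | rfl | rfl | rfl)
    · exact (W.ux_zero_left y).le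
    · exact (W.ux_zero_right y).le
    · exact W.ux_bed_nonpos hL hm ⟨k1, k2⟩
    · exact hux x ⟨k1, k2⟩
  · intro x y k1 k2 k3 k4 k5
    refine le_trans ?_ (W.laplacian_ux_ge hL h2 hm ⟨k1.le, k2.le⟩ ⟨k3, k4⟩)
    exact mul_nonneg (neg_nonneg.2 (h1 _ (W.ψ_mem_Icc ⟨k3.le, k4.le⟩))) k5.le

lemma hasDerivAt_surface (hL : 0 < L) {f : ℝ × ℝ → ℝ} (hf : Differentiable ℝ f) (x : ℝ) :
    HasDerivAt (fun t => f (t, W.η t)) (pdX f (x, W.η x) +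
      W.v (x, W.η x) / W.u (x, W.η x) * pdY f (x, W.η x)) x :=
  hasDerivAt_comp_graph hf (W.hasDerivAt_η hL x)

/-- Bernoulli's law on the free surface, in terms of `γ 0`. -/
lemma bernoulli' (hL : 0 < L) (x : ℝ) :
    (W.u (x, W.η x) ^ 2 - W.v (x, W.η x) ^ 2) * pdX W.u (x, W.η x) + W.v (x, W.η x) *
      (2 * (W.u (x, W.η x) * pdX W.v (x, W.η x)) - W.γ 0 * W.u (x, W.η x) + g) = 0 := by
  have h := W.bernoulli hL x
  rw [W.surface_uy hL] at h
  linear_combination h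

lemma pdY_vx_surface (hL : 0 < L) (x : ℝ) :
    pdY (pdX W.v) (x, W.η x) = -pdX (pdX W.u) (x, W.η x) := by
  rw [← pdX_pdY_comm (W.v_smooth.of_le (by norm_num))]
  exact W.vxy_eq hL (W.surface_mem hL x)

lemma vxx_surface (hL : 0 < L) (x : ℝ) :
    pdX (pdX W.v) (x, W.η x) = pdY (pdX W.u) (x, W.η x) - W.γ₁ 0 * W.v (x, W.η x) := by
  have := W.uxy_eq hL (W.surface_mem hL x)
  simp only [W.psi_surface] at this
  linarith

/-- Bernoulli's law, differentiated twice along the free surface. -/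
lemma bernoulli_deriv (hL : 0 < L) (x : ℝ) :
    (W.u (x, W.η x) ^ 2 - W.v (x, W.η x) ^ 2) * (pdX (pdX W.u) (x, W.η x) +
        W.v (x, W.η x) / W.u (x, W.η x) * pdY (pdX W.u) (x, W.η x)) +
      (2 * W.u (x, W.η x) * (pdX W.u (x, W.η x) +
        W.v (x, W.η x) / W.u (x, W.η x) * pdY W.u (x, W.η x)) - 2 * W.v (x, W.η x) *
        (pdX W.v (x, W.η x) + W.v (x, W.η x) / W.u (x, W.η x) * pdY W.v (x, W.η x))) *
        pdX W.u (x, W.η x) +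
      (pdX W.v (x, W.η x) + W.v (x, W.η x) / W.u (x, W.η x) * pdY W.v (x, W.η x)) *
      (2 * (W.u (x, W.η x) * pdX W.v (x, W.η x)) - W.γ 0 * W.u (x, W.η x) + g) +
      W.v (x, W.η x) * ((2 * pdX W.v (x, W.η x) - W.γ 0) * (pdX W.u (x, W.η x) +
        W.v (x, W.η x) / W.u (x, W.η x) * pdY W.u (x, W.η x)) + 2 * W.u (x, W.η x) *
        (pdX (pdX W.v) (x, W.η x) +
          W.v (x, W.η x) / W.u (x, W.η x) * pdY (pdX W.v) (x, W.η x))) = 0 := by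
  have hu := W.hasDerivAt_surface hL W.differentiable_u x
  have hv := W.hasDerivAt_surface hL W.differentiable_v x
  have hux := W.hasDerivAt_surface hL W.contDiff_ux.differentiable_two x
  have hvx := W.hasDerivAt_surface hL W.contDiff_vx.differentiable_two x
  have h := (((hu.fun_pow 2).fun_sub (hv.fun_pow 2)).fun_mul hux).fun_add
    (hv.fun_mul ((((hu.fun_mul hvx).const_mul 2).fun_sub (hu.const_mul (W.γ 0))).add_const g))
  have h0 := h.unique ((hasDerivAt_const x (0 : ℝ)).congr_of_eventuallyEq
    (Eventually.of_forall (W.bernoulli' hL)))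
  push_cast at h0
  linear_combination h0

lemma g_add_pos (hg : 0 < g) (h0 : ∀ s ∈ Icc 0 W.m, W.γ s ≤ 0) {p : ℝ × ℝ}
    (hp : p ∈ W.fluidBar) : 0 < g + W.γ (W.ψ p) * W.u p := by
  have := mul_nonneg_of_nonpos_of_nonpos (h0 _ (W.ψ_mem_Icc hp))
    (W.u_neg (x := p.1) (y := p.2) hp).le
  linarith

lemma ux_surface_neg (hg : 0 < g) (hL : 0 < L) (h0 : ∀ s ∈ Icc 0 W.m, W.γ s ≤ 0)
    (h1 : ∀ s ∈ Icc 0 W.m, W.γ₁ s ≤ 0)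
    (h2 : ∀ s ∈ Icc 0 W.m, W.γ₂ s ≤ 0) (hm : W.MonotoneHalf)
    (hux : ∀ x ∈ Icc 0 L, pdX W.u (x, W.η x) ≤ 0) {x : ℝ} (hx : x ∈ Ioo 0 L) :
    pdX W.u (x, W.η x) < 0 := by
  refine lt_of_le_of_ne (hux x (Ioo_subset_Icc_self hx)) fun hzero => ?_
  have hu := W.u_neg (W.surface_mem hL x)
  have hv := W.v_pos_surface hm hx
  have huxy : 0 ≤ pdY (pdX W.u) (x, W.η x) := by
    refine (hasDerivAt_pdY W.contDiff_ux.differentiable_two x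
      (W.η x)).nonneg_of_eventually_left_le ?_
    filter_upwards [W.eventually_left_mem_fluid hL x] with t ht
    rw [hzero]
    exact W.ux_nonpos hL h1 h2 hm hux (Ioo_subset_Icc_self hx) (W.fluid_subset_fluidBar ht)
  have hmax : IsLocalMax (fun t => pdX W.u (t, W.η t)) x := by
    filter_upwards [Ioo_mem_nhds hx.1 hx.2] with t ht
    rw [hzero]
    exact hux t (Ioo_subset_Icc_self ht)
  have htan := hmax.hasDerivAt_eq_zero (W.hasDerivAt_surface hL W.contDiff_ux.differentiable_two x)
  have hQ := W.bernoulli' hL x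
  rw [hzero, mul_zero, zero_add] at hQ
  replace hQ := (mul_eq_zero.1 hQ).resolve_left hv.ne'
  have hD := W.bernoulli_deriv hL x
  rw [hzero, hQ, htan, mul_zero, mul_zero, mul_zero, zero_add, zero_add, zero_add,
    W.pdY_vx_surface hL, W.vxx_surface hL] at hD
  replace hD := (mul_eq_zero.1 hD).resolve_left hv.ne'
  have hg' := W.g_add_pos hg h0 (W.surface_mem hL x)
  have huy := W.surface_uy hL x
  have hγ := h1 0 (left_mem_Icc.2 W.m_pos.le)
  rw [W.psi_surface] at hg'
  have hw : W.v (x, W.η x) / W.u (x, W.η x) < 0 := div_neg_of_pos_of_neg hv hu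
  generalize W.u (x, W.η x) = u at *
  generalize W.v (x, W.η x) = v at *
  generalize v / u = w at *
  generalize pdY W.u (x, W.η x) = uy at *
  generalize pdX W.v (x, W.η x) = vx at *
  generalize pdY (pdX W.u) (x, W.η x) = uxy at *
  generalize pdX (pdX W.u) (x, W.η x) = uxx at *
  have e1 : uxx = -w * uxy := by linarith
  subst e1
  have e2 : u ^ 2 * ((2 * vx - W.γ 0) * uy) = g * (g + W.γ 0 * u) / 2 := by
    subst huy
    linear_combination (u * vx - u * W.γ 0 - g / 2) * hQ
  have e3 : 0 < (2 * vx - W.γ 0) * uy := by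
    refine pos_of_mul_pos_right (a := u ^ 2) ?_ (sq_nonneg u)
    rw [e2]
    positivity
  have e4 : w * ((2 * vx - W.γ 0) * uy) < 0 := mul_neg_of_neg_of_pos hw e3
  have e5 : u * (uxy * (1 + w ^ 2)) ≤ 0 :=
    mul_nonpos_of_nonpos_of_nonneg hu.le (by positivity)
  have e6 : 0 ≤ u * (W.γ₁ 0 * v) :=
    mul_nonneg_of_nonpos_of_nonpos hu.le (mul_nonpos_of_nonpos_of_nonneg hγ hv.le)
  nlinarith

lemma ux_neg (hg : 0 < g) (hL : 0 < L) (h0 : ∀ s ∈ Icc 0 W.m, W.γ s ≤ 0)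
    (h1 : ∀ s ∈ Icc 0 W.m, W.γ₁ s ≤ 0)
    (h2 : ∀ s ∈ Icc 0 W.m, W.γ₂ s ≤ 0) (hm : W.MonotoneHalf)
    (hux : ∀ x ∈ Icc 0 L, pdX W.u (x, W.η x) ≤ 0) {p : ℝ × ℝ} (hp : p ∈ W.Ωplus ∪ W.Splus) :
    pdX W.u p < 0 := by
  obtain ⟨x₀, y₀⟩ := p
  rcases hp with ⟨hx0, hxL, hy1, hy2⟩ | ⟨hx0, hxL, hy⟩
  swap
  · simp only at hx0 hxL hy
    subst hy
    exact W.ux_surface_neg hg hL h0 h1 h2 hm hux ⟨hx0, hxL⟩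
  simp only at hx0 hxL hy1 hy2
  obtain ⟨δ, hδ, hδ0, hδL⟩ : ∃ δ > 0, 0 < x₀ - δ ∧ x₀ + δ < L := by
    refine ⟨min x₀ (L - x₀) / 2, by have := lt_min hx0 (sub_pos.2 hxL); linarith, ?_, ?_⟩
    · linarith [min_le_left x₀ (L - x₀)]
    · linarith [min_le_right x₀ (L - x₀), lt_min hx0 (sub_pos.2 hxL)]
  obtain ⟨C, hC⟩ := isCompact_Icc.bddBelow_image W.contDiffOn_γ₁.continuousOn
  have hC' : ∀ s ∈ Icc 0 W.m, C ≤ W.γ₁ s := fun s hs => hC ⟨s, hs, rfl⟩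
  have hC0 : C ≤ 0 := (hC' 0 (left_mem_Icc.2 W.m_pos.le)).trans (h1 0 (left_mem_Icc.2 W.m_pos.le))
  set k := Real.pi / (2 * δ) with hk
  have hkpos : 0 < k := by positivity
  have hkδ : k * δ = Real.pi / 2 := by rw [hk]; field_simp
  set β := Real.sqrt (k ^ 2 - C) with hβ
  have hβpos : 0 < β := Real.sqrt_pos.2 (by nlinarith)
  have hβsq : β ^ 2 = k ^ 2 - C := Real.sq_sqrt (by nlinarith)
  have hz0 : ∀ x y, x₀ - δ ≤ x → x ≤ x₀ + δ → -W.d ≤ y →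
      0 ≤ Real.cos (k * (x - x₀)) * Real.sinh (β * (y + W.d)) := by
    intro x y a1 a2 a3
    refine mul_nonneg (Real.cos_nonneg_of_mem_Icc ⟨?_, ?_⟩) (Real.sinh_nonneg_iff.2 ?_)
    · nlinarith
    · nlinarith
    · exact mul_nonneg hβpos.le (by linarith)
  obtain ⟨Z, hZ⟩ := (isCompact_subgraph W.η_smooth.continuous (x₀ - δ) (x₀ + δ)
    (-W.d)).bddAbove_image (f := fun p : ℝ × ℝ =>
      Real.cos (k * (p.1 - x₀)) * Real.sinh (β * (p.2 + W.d))) (by fun_prop)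
  have hZ' : ∀ x y, x₀ - δ ≤ x → x ≤ x₀ + δ → -W.d ≤ y → y ≤ W.η x →
      Real.cos (k * (x - x₀)) * Real.sinh (β * (y + W.d)) ≤ Z := fun x y a1 a2 a3 a4 =>
    hZ ⟨(x, y), ⟨a1, a2, a3, a4⟩, rfl⟩
  have hZ0 : 0 ≤ Z := (hz0 x₀ y₀ (by linarith) (by linarith) hy1.le).trans
    (hZ' x₀ y₀ (by linarith) (by linarith) hy1.le hy2.le)
  obtain ⟨x₁, hx₁, hmax⟩ := (isCompact_Icc (a := x₀ - δ) (b := x₀ + δ)).exists_isMaxOn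
    ⟨x₀, by linarith, by linarith⟩
    (f := fun t => pdX W.u (t, W.η t))
    (W.contDiff_ux.continuous.comp (by have := W.η_smooth.continuous; fun_prop)).continuousOn
  have hμ := W.ux_surface_neg hg hL h0 h1 h2 hm hux
    (x := x₁) ⟨by linarith [hx₁.1], by linarith [hx₁.2]⟩
  set μ := -pdX W.u (x₁, W.η x₁) with hμdef
  have hμpos : 0 < μ := by linarith
  set ε := μ / (Z + 1) with hε
  have hεpos : 0 < ε := by positivity
  have hεZ : ε * Z ≤ μ := by
    have : ε * (Z + 1) = μ := by rw [hε]; field_simp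
    nlinarith
  set z : ℝ × ℝ → ℝ := fun p => ε * (Real.cos (k * (p.1 - x₀)) * Real.sinh (β * (p.2 + W.d)))
    with hz
  have hzC : ContDiff ℝ 3 z := by
    have := Real.contDiff_cos (n := 3)
    have := Real.contDiff_sinh (n := 3)
    fun_prop
  have hzx : ∀ x y, HasDerivAt (fun t => z (t, y))
      (ε * (-Real.sin (k * (x - x₀)) * k * Real.sinh (β * (y + W.d)))) x := by
    intro x y
    have := ((((hasDerivAt_id' x).sub_const x₀).const_mul k).cos.mul_const
      (Real.sinh (β * (y + W.d)))).const_mul ε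
    simpa using this
  have hzxx : ∀ x y, pdX (pdX z) (x, y) = -(k ^ 2) * z (x, y) := by
    intro x y
    have e : pdX z = fun p => ε * (-Real.sin (k * (p.1 - x₀)) * k * Real.sinh (β * (p.2 + W.d))) :=
      funext fun p => (hasDerivAt_pdX (hzC.differentiable (by norm_num)) p.1 p.2).unique (hzx _ _)
    have h := hasDerivAt_pdX (hzC.pdX (n := 2)).differentiable_two x y
    refine h.unique ?_
    rw [e]
    have := (((((hasDerivAt_id' x).sub_const x₀).const_mul k).sin.fun_neg.mul_const k).mul_const
      (Real.sinh (β * (y + W.d)))).const_mul ε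
    refine this.congr_deriv ?_
    simp only [hz]
    ring
  have hzy : ∀ x y, HasDerivAt (fun t => z (x, t))
      (ε * (Real.cos (k * (x - x₀)) * (Real.cosh (β * (y + W.d)) * β))) y := by
    intro x y
    have := ((((hasDerivAt_id' y).add_const W.d).const_mul β).sinh.const_mul
      (Real.cos (k * (x - x₀)))).const_mul ε
    simpa using this
  have hzyy : ∀ x y, pdY (pdY z) (x, y) = β ^ 2 * z (x, y) := by
    intro x y
    have e : pdY z = fun p => ε * (Real.cos (k * (p.1 - x₀)) * (Real.cosh (β * (p.2 + W.d)) * β)) :=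
      funext fun p => (hasDerivAt_pdY (hzC.differentiable (by norm_num)) p.1 p.2).unique (hzy _ _)
    have h := hasDerivAt_pdY (hzC.pdY (n := 2)).differentiable_two x y
    refine h.unique ?_
    rw [e]
    have := (((((hasDerivAt_id' y).add_const W.d).const_mul β).cosh.mul_const β).const_mul
      (Real.cos (k * (x - x₀)))).const_mul ε
    refine this.congr_deriv ?_
    simp only [hz]
    ring
  have hX : pdX (fun p => pdX W.u p + z p) = fun p => pdX (pdX W.u) p + pdX z p := funext fun p =>
    (hasDerivAt_pdX (W.contDiff_ux.differentiable_two.add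
      (hzC.differentiable (by norm_num))) p.1 p.2).unique
      ((hasDerivAt_pdX W.contDiff_ux.differentiable_two p.1 p.2).fun_add
        (hasDerivAt_pdX (hzC.differentiable (by norm_num)) p.1 p.2))
  have hY : pdY (fun p => pdX W.u p + z p) = fun p => pdY (pdX W.u) p + pdY z p := funext fun p =>
    (hasDerivAt_pdY (W.contDiff_ux.differentiable_two.add
      (hzC.differentiable (by norm_num))) p.1 p.2).unique
      ((hasDerivAt_pdY W.contDiff_ux.differentiable_two p.1 p.2).fun_add
        (hasDerivAt_pdY (hzC.differentiable (by norm_num)) p.1 p.2))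
  have hc2 : ContDiff ℝ 2 fun p => pdX W.u p + z p := W.contDiff_ux.add (hzC.of_le (by norm_num))
  have hXX : ∀ x y, pdX (pdX (fun p => pdX W.u p + z p)) (x, y)
      = pdX (pdX (pdX W.u)) (x, y) + pdX (pdX z) (x, y) := fun x y => by
    have h := hasDerivAt_pdX (hc2.pdX (n := 1)).differentiable_one x y
    refine h.unique ?_
    rw [hX]
    exact (hasDerivAt_pdX (W.contDiff_ux.pdX (n := 1)).differentiable_one x y).fun_add
      (hasDerivAt_pdX (hzC.pdX (n := 2)).differentiable_two x y)
  have hYY : ∀ x y, pdY (pdY (fun p => pdX W.u p + z p)) (x, y)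
      = pdY (pdY (pdX W.u)) (x, y) + pdY (pdY z) (x, y) := fun x y => by
    have h := hasDerivAt_pdY (hc2.pdY (n := 1)).differentiable_one x y
    refine h.unique ?_
    rw [hY]
    exact (hasDerivAt_pdY (W.contDiff_ux.pdY (n := 1)).differentiable_one x y).fun_add
      (hasDerivAt_pdY (hzC.pdY (n := 2)).differentiable_two x y)
  have key : pdX W.u (x₀, y₀) + z (x₀, y₀) ≤ 0 := by
    refine nonpos_of_subharmonic_of_pos W.η_smooth.continuous (a := x₀ - δ) (b := x₀ + δ)
      (c := -W.d) hc2 ?_ ?_ x₀ y₀ (by linarith) (by linarith) hy1.le hy2.le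
    · intro x y a1 a2 a3 a4 hb
      have hxx : x ∈ Icc 0 L := ⟨by linarith, by linarith⟩
      have hn := W.ux_nonpos hL h1 h2 hm hux hxx ⟨a3, a4⟩
      rcases hb with rfl | rfl | rfl | rfl
      · have : k * (x₀ - δ - x₀) = -(Real.pi / 2) := by rw [← hkδ]; ring
        simp only [hz, this, Real.cos_neg, Real.cos_pi_div_two]
        linarith
      · have : k * (x₀ + δ - x₀) = Real.pi / 2 := by rw [← hkδ]; ring
        simp only [hz, this, Real.cos_pi_div_two]
        linarith
      · simp only [hz, neg_add_cancel, mul_zero, Real.sinh_zero]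
        linarith
      · have b1 : pdX W.u (x, W.η x) ≤ pdX W.u (x₁, W.η x₁) := hmax ⟨a1, a2⟩
        have b2 := mul_le_mul_of_nonneg_left (hZ' x _ a1 a2 a3 a4) hεpos.le
        simp only [hz]
        linarith
    · intro x y a1 a2 a3 a4 hpos
      have b1 := W.laplacian_ux_ge hL h2 hm (x := x) ⟨by linarith, by linarith⟩ ⟨a3, a4⟩
      have hzp : 0 ≤ z (x, y) := mul_nonneg hεpos.le (hz0 x y a1.le a2.le a3.le)
      have hs := W.ψ_mem_Icc (p := (x, y)) ⟨a3.le, a4.le⟩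
      have b2 := mul_le_mul_of_nonneg_right (hC' _ hs) hzp
      have b3 := mul_nonneg (neg_nonneg.2 (h1 _ hs)) hpos.le
      rw [hXX, hYY, hzxx, hzyy, hβsq]
      linarith
  have hzpos : 0 < z (x₀, y₀) := by
    simp only [hz, sub_self, mul_zero, Real.cos_zero, one_mul]
    exact mul_pos hεpos (Real.sinh_pos_iff.2 (mul_pos hβpos (by linarith)))
  linarith

/-- The slope of the streamlines is bounded by its maximum on the surface, which obeys the sharp
bound. -/
lemma exists_slope_bound (hg : 0 < g) (hL : 0 < L) (h0 : ∀ s ∈ Icc 0 W.m, W.γ s ≤ 0)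
    (h1 : ∀ s ∈ Icc 0 W.m, W.γ₁ s ≤ 0)
    (h2 : ∀ s ∈ Icc 0 W.m, W.γ₂ s ≤ 0) (hm : W.MonotoneHalf)
    (hux : ∀ x ∈ Icc 0 L, pdX W.u (x, W.η x) ≤ 0) :
    ∃ x₀ ∈ Ioo 0 L, ∃ s > 0, (∀ x y, x ∈ Icc 0 L → (x, y) ∈ W.fluidBar →
        W.v (x, y) + s * W.u (x, y) ≤ 0) ∧
      s ^ 2 * (g + W.γ 0 * W.u (x₀, W.η x₀)) < g - W.γ 0 * W.u (x₀, W.η x₀) := by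
  have hcη := W.η_smooth.continuous
  have hcu : Continuous fun t => W.u (t, W.η t) := W.u_smooth.continuous.comp (by fun_prop)
  have hcv : Continuous fun t => W.v (t, W.η t) := W.v_smooth.continuous.comp (by fun_prop)
  have hneg := fun x => W.u_neg (W.surface_mem hL x)
  obtain ⟨x₀, hx₀, hmax⟩ := (isCompact_Icc (a := 0) (b := L)).exists_isMaxOn
    ⟨0, by simp [hL.le]⟩ (f := fun t => -W.v (t, W.η t) / W.u (t, W.η t))
    (hcv.neg.div hcu fun t => (hneg t).ne).continuousOn
  set s := -W.v (x₀, W.η x₀) / W.u (x₀, W.η x₀) with hs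
  have hspos : 0 < s := by
    have hmid : L / 2 ∈ Ioo 0 L := ⟨by linarith, by linarith⟩
    have := hmax (Ioo_subset_Icc_self hmid)
    exact (div_pos_of_neg_of_neg (neg_neg_iff_pos.2 (W.v_pos_surface hm hmid))
      (hneg (L / 2))).trans_le this
  have hx₀' : x₀ ∈ Ioo 0 L := by
    refine ⟨lt_of_le_of_ne hx₀.1 ?_, lt_of_le_of_ne hx₀.2 ?_⟩
    · rintro rfl
      simp [W.v_zero_left] at hs
      linarith
    · rintro rfl
      simp [W.v_zero_right] at hs
      linarith
  have hsurf : ∀ x ∈ Icc 0 L, W.v (x, W.η x) + s * W.u (x, W.η x) ≤ 0 := by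
    intro x hx
    have := hmax hx
    simp only [mem_ofPred_eq] at this
    rw [div_le_iff_of_neg (hneg x)] at this
    linarith
  have hveq : W.v (x₀, W.η x₀) = -s * W.u (x₀, W.η x₀) := by
    have := (hneg x₀).ne
    rw [hs]
    field_simp
  refine ⟨x₀, hx₀', s, hspos, ?_, ?_⟩
  · intro x y hx hp
    have hcd : ContDiff ℝ 3 fun p => W.v p + s * W.u p :=
      W.v_smooth.add (contDiff_const.mul W.u_smooth)
    have hX : pdX (fun p => W.v p + s * W.u p) = fun p => pdX W.v p + s * pdX W.u p :=
      funext fun p => (hasDerivAt_pdX (hcd.differentiable (by norm_num)) p.1 p.2).unique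
        ((hasDerivAt_pdX W.differentiable_v p.1 p.2).fun_add
          ((hasDerivAt_pdX W.differentiable_u p.1 p.2).const_mul s))
    have hY : pdY (fun p => W.v p + s * W.u p) = fun p => pdY W.v p + s * pdY W.u p :=
      funext fun p => (hasDerivAt_pdY (hcd.differentiable (by norm_num)) p.1 p.2).unique
        ((hasDerivAt_pdY W.differentiable_v p.1 p.2).fun_add
          ((hasDerivAt_pdY W.differentiable_u p.1 p.2).const_mul s))
    refine nonpos_of_subharmonic_of_pos hcη (a := 0) (b := L) (c := -W.d)
      (hcd.of_le (by norm_num)) ?_ ?_ x y hx.1 hx.2 hp.1 hp.2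
    · intro x y k1 k2 k3 k4 hb
      have hsu : s * W.u (x, y) ≤ 0 :=
        mul_nonpos_of_nonneg_of_nonpos hspos.le (W.u_neg ⟨k3, k4⟩).le
      rcases hb with rfl | rfl | rfl | rfl
      · rwa [W.v_zero_left, zero_add]
      · rwa [W.v_zero_right, zero_add]
      · rwa [W.bed_kinematic, zero_add]
      · exact hsurf x ⟨k1, k2⟩
    · intro x y k1 k2 k3 k4 hpos
      have hXX : pdX (pdX fun p => W.v p + s * W.u p) (x, y)
          = pdX (pdX W.v) (x, y) + s * pdX (pdX W.u) (x, y) := by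
        have h := hasDerivAt_pdX (hcd.pdX (n := 2)).differentiable_two x y
        refine h.unique ?_
        rw [hX]
        exact (hasDerivAt_pdX W.contDiff_vx.differentiable_two x y).fun_add
          ((hasDerivAt_pdX W.contDiff_ux.differentiable_two x y).const_mul s)
      have hYY : pdY (pdY fun p => W.v p + s * W.u p) (x, y)
          = pdY (pdY W.v) (x, y) + s * pdY (pdY W.u) (x, y) := by
        have h := hasDerivAt_pdY (hcd.pdY (n := 2)).differentiable_two x y
        refine h.unique ?_
        rw [hY]
        exact (hasDerivAt_pdY W.contDiff_vy.differentiable_two x y).fun_add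
          ((hasDerivAt_pdY W.contDiff_uy.differentiable_two x y).const_mul s)
      have hq : (x, y) ∈ W.fluid := ⟨k3, k4⟩
      have b3 := mul_nonneg (neg_nonneg.2 (h1 _ (W.ψ_mem_Icc (W.fluid_subset_fluidBar hq)))) hpos.le
      have c1 := W.vyy_eq_fluid hL hq
      have c2 := W.uyy_eq_fluid hL hq
      have c3 := W.uxy_eq_fluid hL hq
      simp only at c1 c2 c3
      rw [hXX, hYY, c1, c2, c3]
      linarith
  · have hloc : IsLocalMax (fun t => W.v (t, W.η t) + s * W.u (t, W.η t)) x₀ := by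
      filter_upwards [Ioo_mem_nhds hx₀'.1 hx₀'.2] with t ht
      rw [hveq, neg_mul, neg_add_cancel]
      exact hsurf t (Ioo_subset_Icc_self ht)
    have hT := hloc.hasDerivAt_eq_zero
      ((W.hasDerivAt_surface hL W.differentiable_v x₀).fun_add
        ((W.hasDerivAt_surface hL W.differentiable_u x₀).const_mul s))
    have hw : W.v (x₀, W.η x₀) / W.u (x₀, W.η x₀) = -s := by rw [hs]; ring
    have hB := W.bernoulli' hL x₀
    have hvy := W.vy_eq hL (W.surface_mem hL x₀)
    simp only at hvy
    have hn := W.ux_surface_neg hg hL h0 h1 h2 hm hux hx₀'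
    have hu := hneg x₀
    rw [hw, hvy, W.surface_uy hL] at hT
    rw [hveq] at hB
    generalize W.u (x₀, W.η x₀) = u at *
    generalize pdX W.v (x₀, W.η x₀) = vx at *
    generalize pdX W.u (x₀, W.η x₀) = ux at *
    have hB' : u * (1 - s ^ 2) * ux - s * (2 * (u * vx) - W.γ 0 * u + g) = 0 := by
      refine mul_left_cancel₀ hu.ne ?_
      linear_combination hB
    have hid : u * ux * ((1 - s ^ 2) ^ 2 + 4 * s ^ 2) =
        s * ((g - W.γ 0 * u) - s ^ 2 * (g + W.γ 0 * u)) := by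
      linear_combination (1 - s ^ 2) * hB' + 2 * s * u * hT
    have hl : 0 < u * ux * ((1 - s ^ 2) ^ 2 + 4 * s ^ 2) :=
      mul_pos (mul_pos_of_neg_of_neg hu hn) (by positivity)
    rw [hid] at hl
    linarith [pos_of_mul_pos_right hl hspos.le]

end PeriodicWave

end Monotone

section Crest

open Filter Topology

namespace PeriodicWave

variable {g Patm L : ℝ} (W : PeriodicWave g Patm L)

lemma η_antitoneOn (hL : 0 < L) (hm : W.MonotoneHalf) : AntitoneOn W.η (Icc 0 L) := by
  refine antitoneOn_of_deriv_nonpos (convex_Icc _ _) W.η_smooth.continuous.continuousOn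
    W.differentiable_η.differentiableOn fun x hx => ?_
  rw [interior_Icc] at hx
  rw [(W.hasDerivAt_η hL x).deriv]
  exact div_nonpos_of_nonneg_of_nonpos (W.v_pos_surface hm hx).le (W.u_neg (W.surface_mem hL x)).le

/-- Bernoulli's law, integrated along the free surface. -/
lemma bernoulli_const (hL : 0 < L) (x y : ℝ) :
    W.u (x, W.η x) ^ 2 + W.v (x, W.η x) ^ 2 + 2 * g * W.η x =
      W.u (y, W.η y) ^ 2 + W.v (y, W.η y) ^ 2 + 2 * g * W.η y := by
  have h : ∀ t, HasDerivAt
      (fun t => W.u (t, W.η t) ^ 2 + W.v (t, W.η t) ^ 2 + 2 * g * W.η t) 0 t := by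
    intro t
    refine ((((W.hasDerivAt_surface hL W.differentiable_u t).fun_pow 2).fun_add
      ((W.hasDerivAt_surface hL W.differentiable_v t).fun_pow 2)).fun_add
        ((W.hasDerivAt_η hL t).const_mul (2 * g))).congr_deriv ?_
    have h1 := W.bernoulli hL t
    have h4 := W.vy_eq hL (W.surface_mem hL t)
    have hu := (W.u_neg (W.surface_mem hL t)).ne
    simp only at h4
    rw [h4]
    refine mul_left_cancel₀ hu ?_
    push_cast
    field_simp
    linear_combination 2 * h1
  exact is_const_of_deriv_eq_zero (fun t => (h t).differentiableAt) (fun t => (h t).deriv) x y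

lemma crest_pos (hg : 0 < g) (hL : 0 < L) (h0 : ∀ s ∈ Icc 0 W.m, W.γ s ≤ 0)
    (hm : W.MonotoneHalf) (htr : 0 < g - W.γ 0 * W.u (L, W.η L)) :
    0 < g - W.γ 0 * W.u (0, W.η 0) := by
  have h1 := W.bernoulli_const hL 0 L
  rw [W.v_zero_left, W.v_zero_right] at h1
  have h2 := W.η_antitoneOn hL hm (left_mem_Icc.2 hL.le) (right_mem_Icc.2 hL.le) hL.le
  have h3 := W.u_neg (W.surface_mem hL 0)
  have h4 := W.u_neg (W.surface_mem hL L)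
  have h5 : W.u (L, W.η L) ≤ W.u (0, W.η 0) := by
    have : W.u (0, W.η 0) ^ 2 ≤ W.u (L, W.η L) ^ 2 := by nlinarith
    have := sq_le_sq.1 this
    rw [abs_of_neg h3, abs_of_neg h4] at this
    linarith
  have h6 := h0 0 (left_mem_Icc.2 W.m_pos.le)
  nlinarith

lemma surface_sq_lt (hg : 0 < g) (hL : 0 < L) (h0 : ∀ s ∈ Icc 0 W.m, W.γ s ≤ 0)
    (h1 : ∀ s ∈ Icc 0 W.m, W.γ₁ s ≤ 0)
    (h2 : ∀ s ∈ Icc 0 W.m, W.γ₂ s ≤ 0) (hm : W.MonotoneHalf)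
    (hux : ∀ x ∈ Icc 0 L, pdX W.u (x, W.η x) ≤ 0) {x : ℝ} (hx : x ∈ Icc 0 L) :
    0 < W.u (x, W.η x) ^ 2 - W.v (x, W.η x) ^ 2 := by
  obtain ⟨x₀, -, s, hs, hle, hlt⟩ := W.exists_slope_bound hg hL h0 h1 h2 hm hux
  have k1 := hle x _ hx (W.surface_mem hL x)
  have k2 := W.v_nonneg hm hx (W.surface_mem hL x)
  have k3 := W.u_neg (W.surface_mem hL x)
  have k4 : 0 ≤ W.γ 0 * W.u (x₀, W.η x₀) :=
    mul_nonneg_of_nonpos_of_nonpos (h0 0 (left_mem_Icc.2 W.m_pos.le))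
      (W.u_neg (W.surface_mem hL x₀)).le
  have k5 : s < 1 := by
    by_contra! hs1
    have k6 : 1 ≤ s ^ 2 := one_le_pow₀ hs1
    have k7 : 0 ≤ g + W.γ 0 * W.u (x₀, W.η x₀) := by linarith
    linarith [mul_le_mul_of_nonneg_right k6 k7]
  have k8 : W.v (x, W.η x) < -W.u (x, W.η x) := by nlinarith
  nlinarith

lemma factor_pos_interior (hg : 0 < g) (hL : 0 < L) (h0 : ∀ s ∈ Icc 0 W.m, W.γ s ≤ 0)
    (h1 : ∀ s ∈ Icc 0 W.m, W.γ₁ s ≤ 0)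
    (h2 : ∀ s ∈ Icc 0 W.m, W.γ₂ s ≤ 0) (hm : W.MonotoneHalf)
    (hux : ∀ x ∈ Icc 0 L, pdX W.u (x, W.η x) ≤ 0) {x : ℝ} (hx : x ∈ Ioo 0 L) :
    0 < 2 * (W.u (x, W.η x) * pdX W.v (x, W.η x)) - W.γ 0 * W.u (x, W.η x) + g := by
  have k1 := W.surface_sq_lt hg hL h0 h1 h2 hm hux (Ioo_subset_Icc_self hx)
  have k2 := mul_neg_of_pos_of_neg k1 (W.ux_surface_neg hg hL h0 h1 h2 hm hux hx)
  have k3 := W.bernoulli' hL x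
  exact pos_of_mul_pos_right (a := W.v (x, W.η x)) (by linarith) (W.v_pos_surface hm hx).le

lemma factor_pos_trough (hL : 0 < L) (hm : W.MonotoneHalf)
    (htr : 0 < g - W.γ 0 * W.u (L, W.η L)) :
    0 < 2 * (W.u (L, W.η L) * pdX W.v (L, W.η L)) - W.γ 0 * W.u (L, W.η L) + g := by
  have h := (W.hasDerivAt_surface hL W.differentiable_v L).fun_neg
  have k : 0 ≤ -pdX W.v (L, W.η L) := by
    have := h.nonneg_of_eventually_left_le (by
      filter_upwards [Ioo_mem_nhdsLT hL] with t ht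
      rw [W.v_zero_right, neg_zero]
      linarith [W.v_pos_surface hm ht])
    rwa [W.v_zero_right, zero_div, zero_mul, add_zero] at this
  nlinarith [W.u_neg (W.surface_mem hL L)]

lemma factor_even (x : ℝ) :
    2 * (W.u (-x, W.η (-x)) * pdX W.v (-x, W.η (-x))) - W.γ 0 * W.u (-x, W.η (-x)) + g =
      2 * (W.u (x, W.η x) * pdX W.v (x, W.η x)) - W.γ 0 * W.u (x, W.η x) + g := by
  rw [W.η_even, W.u_even, W.vx_even]

lemma vxxx_crest (hL : 0 < L) :
    pdX (pdY (pdX W.u)) (0, W.η 0) =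
      pdX (pdX (pdX W.v)) (0, W.η 0) + W.γ₁ 0 * pdX W.v (0, W.η 0) := by
  have hd := W.neg_d_lt_η hL 0
  have hc : Continuous fun y : ℝ => ((0 : ℝ), y) := by fun_prop
  have heq : EqOn (fun y => pdX (pdY (pdX W.u)) (0, y))
      (fun y => pdX (pdX (pdX W.v)) (0, y) + W.γ₁ (W.ψ (0, y)) * pdX W.v (0, y))
      (Icc (-W.d) (W.η 0)) := by
    refine EqOn.of_subset_closure (s := Ioo (-W.d) (W.η 0)) (fun y hy => ?_) ?_ ?_
      Ioo_subset_Icc_self (by rw [closure_Ioo hd.ne])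
    · have := W.uxxy_eq hL (show (0, y) ∈ W.fluid from hy)
      simpa [W.v_zero_left] using this
    · exact (((W.contDiff_ux.pdY (n := 1)).pdX (n := 0)).continuous.comp hc).continuousOn
    · refine (((W.contDiff_vx.pdX (n := 1)).pdX (n := 0)).continuous.comp hc).continuousOn.add
        (ContinuousOn.mul ?_ (W.contDiff_vx.continuous.comp hc).continuousOn)
      exact W.continuousOn_γ₁ψ.comp hc.continuousOn fun y hy => hy
  have := heq (right_mem_Icc.2 hd.le)
  simpa only [W.psi_surface] using this

lemma factor_pos_crest (hg : 0 < g) (hL : 0 < L) (h0 : ∀ s ∈ Icc 0 W.m, W.γ s ≤ 0)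
    (h1 : ∀ s ∈ Icc 0 W.m, W.γ₁ s ≤ 0)
    (h2 : ∀ s ∈ Icc 0 W.m, W.γ₂ s ≤ 0) (hm : W.MonotoneHalf)
    (htr : 0 < g - W.γ 0 * W.u (L, W.η L))
    (hux : ∀ x ∈ Icc 0 L, pdX W.u (x, W.η x) ≤ 0) :
    0 < 2 * (W.u (0, W.η 0) * pdX W.v (0, W.η 0)) - W.γ 0 * W.u (0, W.η 0) + g := by
  set q : ℝ → ℝ := fun x =>
    2 * (W.u (x, W.η x) * pdX W.v (x, W.η x)) - W.γ 0 * W.u (x, W.η x) + g with hq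
  have hcη := W.η_smooth.continuous
  have hqc : Continuous q := by
    have a1 : Continuous fun t => W.u (t, W.η t) := W.u_smooth.continuous.comp (by fun_prop)
    have a2 : Continuous fun t => pdX W.v (t, W.η t) := W.contDiff_vx.continuous.comp (by fun_prop)
    fun_prop
  have hpos : ∀ x ∈ Ioo 0 L, 0 < q x := fun x hx => W.factor_pos_interior hg hL h0 h1 h2 hm hux hx
  have hq0 : 0 ≤ q 0 := by
    refine ge_of_tendsto (hqc.continuousAt.tendsto.mono_left (nhdsWithin_le_nhds (s := Ioi 0))) ?_
    filter_upwards [Ioo_mem_nhdsGT hL] with t ht using (hpos t ht).le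
  refine lt_of_le_of_ne hq0 fun hzero => ?_
  have hmin : IsLocalMax (fun t => -q t) 0 := by
    filter_upwards [Ioo_mem_nhds (neg_lt_zero.2 hL) hL] with t ht
    have hzero' : q 0 = 0 := hzero.symm
    rw [hzero', neg_zero, neg_nonpos]
    rcases lt_trichotomy t 0 with h | h | h
    · have : q t = q (-t) := (W.factor_even t).symm
      rw [this]
      exact (hpos (-t) ⟨by linarith, by linarith [ht.1]⟩).le
    · rw [h]; exact hq0
    · exact (hpos t ⟨h, ht.2⟩).le
  set G : ℝ × ℝ → ℝ := fun p => 2 * (W.u p * pdX W.v p) - W.γ 0 * W.u p + g with hG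
  have hGC : ContDiff ℝ 2 G := by
    have a1 : ContDiff ℝ 2 W.u := W.u_smooth.of_le (by norm_num)
    have a2 := W.contDiff_vx
    fun_prop
  have hGx : pdX G = fun p => 2 * (pdX W.u p * pdX W.v p + W.u p * pdX (pdX W.v) p)
      - W.γ 0 * pdX W.u p := funext fun p =>
    (hasDerivAt_pdX hGC.differentiable_two p.1 p.2).unique
      (((((hasDerivAt_pdX W.differentiable_u p.1 p.2).fun_mul
        (hasDerivAt_pdX W.contDiff_vx.differentiable_two p.1 p.2)).const_mul 2).fun_sub
          ((hasDerivAt_pdX W.differentiable_u p.1 p.2).const_mul (W.γ 0))).add_const g)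
  have hGy : pdY G = fun p => 2 * (pdY W.u p * pdX W.v p + W.u p * pdY (pdX W.v) p)
      - W.γ 0 * pdY W.u p := funext fun p =>
    (hasDerivAt_pdY hGC.differentiable_two p.1 p.2).unique
      (((((hasDerivAt_pdY W.differentiable_u p.1 p.2).fun_mul
        (hasDerivAt_pdY W.contDiff_vx.differentiable_two p.1 p.2)).const_mul 2).fun_sub
          ((hasDerivAt_pdY W.differentiable_u p.1 p.2).const_mul (W.γ 0))).add_const g)
  have hGxx : pdX (pdX G) (0, W.η 0) =
      2 * (pdX (pdX W.u) (0, W.η 0) * pdX W.v (0, W.η 0) +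
        W.u (0, W.η 0) * pdX (pdX (pdX W.v)) (0, W.η 0))
        - W.γ 0 * pdX (pdX W.u) (0, W.η 0) := by
    have h := hasDerivAt_pdX (hGC.pdX (n := 1)).differentiable_one 0 (W.η 0)
    rw [hGx] at h
    have h' := ((((hasDerivAt_pdX W.contDiff_ux.differentiable_two 0 (W.η 0)).fun_mul
        (hasDerivAt_pdX W.contDiff_vx.differentiable_two 0 (W.η 0))).fun_add
        ((hasDerivAt_pdX W.differentiable_u 0 (W.η 0)).fun_mul
        (hasDerivAt_pdX (W.contDiff_vx.pdX (n := 1)).differentiable_one 0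
          (W.η 0)))).const_mul 2).fun_sub
          ((hasDerivAt_pdX W.contDiff_ux.differentiable_two 0 (W.η 0)).const_mul (W.γ 0))
    rw [hGx, h.unique h', W.ux_zero_left]
    ring
  have hu := W.u_neg (W.surface_mem hL 0)
  have hv0 := W.v_zero_left (W.η 0)
  have hux0 := W.ux_zero_left (W.η 0)
  have hη'' : HasDerivAt (fun t => W.v (t, W.η t) / W.u (t, W.η t))
      (pdX W.v (0, W.η 0) / W.u (0, W.η 0)) 0 := by
    refine ((W.hasDerivAt_surface hL W.differentiable_v 0).fun_div
      (W.hasDerivAt_surface hL W.differentiable_u 0) hu.ne).congr_deriv ?_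
    have hune := hu.ne
    rw [hv0]
    field_simp
    ring
  have hsecond := hmin.second_deriv_nonpos
    (fun t => (W.hasDerivAt_surface hL hGC.differentiable_two t).fun_neg)
    ((W.hasDerivAt_surface hL (hGC.pdX (n := 1)).differentiable_one 0).fun_add
      (hη''.fun_mul (W.hasDerivAt_surface hL (hGC.pdY (n := 1)).differentiable_one 0))).fun_neg
  rw [hv0, zero_div, zero_mul, zero_mul, add_zero, add_zero, hGxx, hGy] at hsecond
  have hQ : 2 * (W.u (0, W.η 0) * pdX W.v (0, W.η 0)) - W.γ 0 * W.u (0, W.η 0) + g = 0 :=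
    hzero.symm
  have huxx : pdX (pdX W.u) (0, W.η 0) = 0 := by
    have h := W.bernoulli_deriv hL 0
    rw [hv0, hux0, hQ] at h
    simpa [hu.ne] using h
  have huxxy : 0 ≤ pdX (pdY (pdX W.u)) (0, W.η 0) := by
    rw [pdX_pdY_comm W.contDiff_ux]
    refine (hasDerivAt_pdY (W.contDiff_ux.pdX (n := 1)).differentiable_one 0
      (W.η 0)).nonneg_of_eventually_left_le ?_
    filter_upwards [W.eventually_left_mem_fluid hL 0] with y hy
    rw [huxx]
    refine neg_nonneg.1 ((hasDerivAt_pdX W.contDiff_ux.differentiable_two 0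
      y).fun_neg.nonneg_of_eventually_right_ge ?_)
    filter_upwards [W.eventually_right_mem_fluidBar hL hy.1.le hy.2] with t ht
    rw [W.ux_zero_left, neg_zero, neg_nonneg]
    exact W.ux_nonpos hL h1 h2 hm hux ht.1 ht.2
  have hvxxx := W.vxxx_crest hL
  have huy := W.surface_uy hL 0
  have hvxy := W.pdY_vx_surface hL 0
  have hcr := W.crest_pos hg hL h0 hm htr
  have hγ0 := h0 0 (left_mem_Icc.2 W.m_pos.le)
  have hγ1 := h1 0 (left_mem_Icc.2 W.m_pos.le)
  simp only at hsecond
  rw [huxx] at hsecond hvxy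
  rw [hvxy] at hsecond
  generalize W.u (0, W.η 0) = u at *
  generalize pdX W.v (0, W.η 0) = vx at *
  generalize pdY W.u (0, W.η 0) = uy at *
  generalize pdX (pdX (pdX W.v)) (0, W.η 0) = vxxx at *
  generalize pdX (pdY (pdX W.u)) (0, W.η 0) = uxxy at *
  have hvx : 0 < vx := by
    by_contra! hvx
    nlinarith [mul_nonneg_of_nonpos_of_nonpos hu.le hvx]
  have huypos : 0 < uy := by linarith
  have e1 : 2 * vx - W.γ 0 = -g / u := by
    rw [eq_div_iff hu.ne]
    linear_combination hQ
  have e2 : vx / u * (2 * (uy * vx + u * -0) - W.γ 0 * uy) = -(g * vx * uy / u ^ 2) := by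
    have : 2 * (uy * vx + u * -0) - W.γ 0 * uy = uy * (2 * vx - W.γ 0) := by ring
    have hune := hu.ne
    rw [this, e1]
    field_simp
  have e3 : 0 < g * vx * uy / u ^ 2 := by
    have := hu.ne
    positivity
  have e4 : u * vxxx ≤ 0 := by
    refine mul_nonpos_of_nonpos_of_nonneg hu.le ?_
    have := mul_nonpos_of_nonpos_of_nonneg hγ1 hvx.le
    linarith
  rw [e2] at hsecond
  linarith

lemma factor_eq (hL : 0 < L) (x : ℝ) :
    W.u (x, W.η x) * (pdX W.v (x, W.η x) + pdY W.u (x, W.η x)) + g =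
      2 * (W.u (x, W.η x) * pdX W.v (x, W.η x)) - W.γ 0 * W.u (x, W.η x) + g := by
  rw [W.surface_uy hL]
  ring

/-- For a wave in `𝒲₀`, the two factors in Bernoulli's law are positive up to crest and trough. -/
lemma factors_pos_of_ux_nonpos (hg : 0 < g) (hL : 0 < L) (hW : W.MemW)
    (htr : 0 < g - W.γ 0 * W.u (L, W.η L)) (hux : ∀ x ∈ Icc 0 L, pdX W.u (x, W.η x) ≤ 0)
    {x : ℝ} (hx : x ∈ Icc 0 L) : 0 < W.u (x, W.η x) ^ 2 - W.v (x, W.η x) ^ 2 ∧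
      0 < W.u (x, W.η x) * (pdX W.v (x, W.η x) + pdY W.u (x, W.η x)) + g := by
  obtain ⟨h0, h1, h2, ht | hm⟩ := hW
  · obtain ⟨tv, tη, tu, -⟩ := ht
    have hu := W.u_neg (W.surface_mem hL x)
    have hvx : pdX W.v (x, W.η x) = 0 := by
      have hv : W.v = fun _ => 0 := funext tv
      simp [pdX, hv]
    rw [W.factor_eq hL, tv, hvx, tη, tu x L 0]
    rw [tη] at htr hu
    rw [tu x L 0] at hu
    constructor
    · simpa using sq_pos_of_neg hu
    · linarith
  · refine ⟨W.surface_sq_lt hg hL h0 h1 h2 hm hux hx, ?_⟩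
    rw [W.factor_eq hL]
    rcases hx.1.eq_or_lt with rfl | k1
    · exact W.factor_pos_crest hg hL h0 h1 h2 hm htr hux
    rcases hx.2.eq_or_lt with rfl | k2
    · exact W.factor_pos_trough hL hm htr
    · exact W.factor_pos_interior hg hL h0 h1 h2 hm hux ⟨k1, k2⟩

lemma ux_nonpos_of_factors_pos (hL : 0 < L) (hW : W.MemW) {x : ℝ} (hx : x ∈ Icc 0 L)
    (h1 : 0 < W.u (x, W.η x) ^ 2 - W.v (x, W.η x) ^ 2)
    (h2 : 0 < W.u (x, W.η x) * (pdX W.v (x, W.η x) + pdY W.u (x, W.η x)) + g) :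
    pdX W.u (x, W.η x) ≤ 0 := by
  have hv : 0 ≤ W.v (x, W.η x) := by
    rcases hW.2.2.2 with ht | hm
    · exact (ht.1 _).ge
    · exact W.v_nonneg hm hx (W.surface_mem hL x)
  have h3 := W.bernoulli hL x
  by_contra! h4
  nlinarith [mul_pos h1 h4, mul_nonneg hv h2.le]

lemma ux_nonpos_of_isTrivial (ht : W.IsTrivial) (p : ℝ × ℝ) : pdX W.u p ≤ 0 := by
  have h1 := hasDerivAt_pdX W.differentiable_u p.1 p.2
  have h2 : (fun t => W.u (t, p.2)) = fun _ => W.u (0, p.2) := funext fun t => ht.2.2.1 t 0 p.2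
  rw [h2] at h1
  exact (h1.unique (hasDerivAt_const _ _)).le

lemma continuous_trace : Continuous W.trace := by
  have hη := W.η_smooth.continuous
  have hc : Continuous fun x => (x, W.η x) := by fun_prop
  exact (W.u_smooth.continuous.comp hc).prodMk <| (W.v_smooth.continuous.comp hc).prodMk <|
    (W.contDiff_ux.continuous.comp hc).prodMk <| (W.contDiff_vx.continuous.comp hc).prodMk <|
    (W.contDiff_uy.continuous.comp hc).prodMk <|
    ((W.contDiff_ux.pdX (n := 1)).continuous.comp hc).prodMk
      ((W.contDiff_ux.pdY (n := 1)).continuous.comp hc)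

/-- Membership in `𝒲₀` propagates along sets of waves with connected trace. -/
lemma ux_nonpos_of_isConnected (hg : 0 < g) (hL : 0 < L) {M : Set (PeriodicWave g Patm L)}
    (hMW : ∀ W ∈ M, W.MemW)
    (hconn : IsConnected {f : C(↥(Set.Icc (0:ℝ) L), ℝ × ℝ × ℝ × ℝ × ℝ × ℝ × ℝ) |
      ∃ W ∈ M, ∀ x : ↥(Set.Icc (0:ℝ) L), f x = W.trace x.1})
    (htriv : ∃ W ∈ M, W.IsTrivial)
    (htrough : ∀ W ∈ M, 0 < g - W.γ 0 * W.u (L, W.η L)) :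
    ∀ W ∈ M, ∀ x ∈ Icc 0 L, pdX W.u (x, W.η x) ≤ 0 := by
  set U : Set C(↥(Set.Icc (0:ℝ) L), ℝ × ℝ × ℝ × ℝ × ℝ × ℝ × ℝ) := {f | MapsTo f univ
    {a | 0 < a.1 ^ 2 - a.2.1 ^ 2 ∧ 0 < a.1 * (a.2.2.2.1 + a.2.2.2.2.1) + g}} with hU
  set F : Set C(↥(Set.Icc (0:ℝ) L), ℝ × ℝ × ℝ × ℝ × ℝ × ℝ × ℝ) :=
    {f | ∀ x, (f x).2.2.1 ≤ 0} with hF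
  have hV : IsOpen {a : ℝ × ℝ × ℝ × ℝ × ℝ × ℝ × ℝ |
      0 < a.1 ^ 2 - a.2.1 ^ 2 ∧ 0 < a.1 * (a.2.2.2.1 + a.2.2.2.2.1) + g} := by
    refine IsOpen.and ?_ ?_
    · exact isOpen_lt continuous_const (by fun_prop)
    · exact isOpen_lt continuous_const (by fun_prop)
  have hUo : IsOpen U := ContinuousMap.isOpen_setOfPred_mapsTo isCompact_univ hV
  have hFc : IsClosed F := by
    rw [hF]
    simp only [ofPred_forall]
    exact isClosed_iInter fun x => isClosed_le
      ((continuous_fst.comp (continuous_snd.comp continuous_snd)).comp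
        (continuous_eval_const x)) continuous_const
  set S := {f : C(↥(Set.Icc (0:ℝ) L), ℝ × ℝ × ℝ × ℝ × ℝ × ℝ × ℝ) |
      ∃ W ∈ M, ∀ x : ↥(Set.Icc (0:ℝ) L), f x = W.trace x.1} with hS
  have hFU : ∀ f ∈ S, f ∈ F → f ∈ U := by
    rintro f ⟨W, hW, hf⟩ hfF x -
    have := W.factors_pos_of_ux_nonpos hg hL (hMW W hW) (htrough W hW) (fun t ht => by
      have := hfF ⟨t, ht⟩
      rwa [hf] at this) x.2
    change _ ∧ _
    rw [hf]
    exact this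
  have hUF : ∀ f ∈ S, f ∈ U → f ∈ F := by
    rintro f ⟨W, hW, hf⟩ hfU x
    have h := hfU (mem_univ x)
    change _ ∧ _ at h
    rw [hf] at h ⊢
    exact W.ux_nonpos_of_factors_pos hL (hMW W hW) x.2 h.1 h.2
  let T : PeriodicWave g Patm L → C(↥(Set.Icc (0:ℝ) L), ℝ × ℝ × ℝ × ℝ × ℝ × ℝ × ℝ) :=
    fun W => ⟨fun x => W.trace x.1, W.continuous_trace.comp continuous_subtype_val⟩
  have hT : ∀ W ∈ M, T W ∈ S := fun W hW => ⟨W, hW, fun _ => rfl⟩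
  have hall : ∀ f ∈ S, f ∈ F := by
    by_contra! ⟨f, hfS, hfF⟩
    obtain ⟨W, hW, ht⟩ := htriv
    have hWF : T W ∈ F := fun x => W.ux_nonpos_of_isTrivial ht _
    obtain ⟨k, hkS, hkU, hkF⟩ := hconn.isPreconnected U Fᶜ hUo hFc.isOpen_compl
      (fun k hk => by
        by_cases h : k ∈ F
        · exact Or.inl (hFU k hk h)
        · exact Or.inr h)
      ⟨T W, hT W hW, hFU _ (hT W hW) hWF⟩ ⟨f, hfS, hfF⟩
    exact hkF (hUF k hkS hkU)
  exact fun W hW x hx => hall (T W) (hT W hW) ⟨x, hx⟩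

end PeriodicWave

end Crest

/-- **Corollary (sharper slope bound, periodic case).**  Under the hypotheses of the main
theorem, every nontrivial wave in `𝓜` satisfies `u_x < 0` on `Ω⁺ ∪ S⁺`, and moreover
`|v/u| < σ` on the closure of `Ω`, where `σ ≥ 0` is defined by
`σ² = max_{Ω̄} (g - γ(ψ)u)/(g + γ(ψ)u)`.  In particular `σ² < 1` if `γ(0) < 0`. -/
theorem periodic_slope_lt_sigma (g Patm L : ℝ) (hg : 0 < g) (hL : 0 < L)
    (M : Set (PeriodicWave g Patm L))
    (hMW : ∀ W ∈ M, W.MemW)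
    (hconn : IsConnected {f : C(↥(Set.Icc (0:ℝ) L), ℝ × ℝ × ℝ × ℝ × ℝ × ℝ × ℝ) |
      ∃ W ∈ M, ∀ x : ↥(Set.Icc (0:ℝ) L), f x = W.trace x.1})
    (htriv : ∃ W ∈ M, W.IsTrivial)
    (htrough : ∀ W ∈ M, 0 < g - W.γ 0 * W.u (L, W.η L)) :
    ∀ W ∈ M, ¬W.IsTrivial →
      (∀ p ∈ W.Ωplus ∪ W.Splus, pdX W.u p < 0) ∧
      (∀ σ : ℝ, 0 ≤ σ →
        IsGreatest ((fun p => (g - W.γ (W.ψ p) * W.u p) / (g + W.γ (W.ψ p) * W.u p)) ''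
          W.Ωbar) (σ ^ 2) →
        (∀ p ∈ W.Ωbar, |W.v p / W.u p| < σ) ∧ (W.γ 0 < 0 → σ ^ 2 < 1)) := by
  intro W hW hnt
  obtain ⟨h0, h1, h2, hm⟩ := hMW W hW
  replace hm := hm.resolve_left hnt
  have hux := PeriodicWave.ux_nonpos_of_isConnected hg hL hMW hconn htriv htrough W hW
  refine ⟨fun p hp => W.ux_neg hg hL h0 h1 h2 hm hux hp, fun σ hσ hmax => ⟨?_, fun hγ => ?_⟩⟩
  · obtain ⟨x₀, hx₀, s, hs, hle, hlt⟩ := W.exists_slope_bound hg hL h0 h1 h2 hm hux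
    have hmem := W.surface_mem hL x₀
    have hsσ : s < σ := by
      have k1 := hmax.2 ⟨(x₀, W.η x₀), ⟨by linarith [hx₀.1], hx₀.2.le, hmem.1, le_rfl⟩, rfl⟩
      have k2 := W.g_add_pos hg h0 hmem
      simp only [W.psi_surface] at k1 k2
      have k3 := (lt_div_iff₀ k2).2 hlt
      exact lt_of_pow_lt_pow_left₀ 2 hσ (k3.trans_le k1)
    rintro ⟨x, y⟩ ⟨hp1, hp2, hp3, hp4⟩
    simp only at hp1 hp2 hp3 hp4
    have hbound : ∀ x y, x ∈ Icc 0 L → (x, y) ∈ W.fluidBar → |W.v (x, y) / W.u (x, y)| < σ := by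
      intro x y hx hp
      have hu := W.u_neg hp
      rw [abs_div, abs_of_neg hu, abs_of_nonneg (W.v_nonneg hm hx hp), div_lt_iff₀ (by linarith)]
      nlinarith [hle x y hx hp]
    rcases le_total 0 x with hx | hx
    · exact hbound x y ⟨hx, hp2⟩ ⟨hp3, hp4⟩
    · have := hbound (-x) y ⟨by linarith, by linarith⟩ ⟨hp3, by rw [W.η_even]; exact hp4⟩
      rwa [W.v_odd, W.u_even, neg_div, abs_neg] at this
  · obtain ⟨p, hp, hpσ⟩ := hmax.1
    have hpm : p ∈ W.fluidBar := hp.2.2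
    have k2 := W.g_add_pos hg h0 hpm
    have hψ := W.ψ_mem_Icc hpm
    have hanti : AntitoneOn W.γ (Icc 0 W.m) := by
      refine antitoneOn_of_deriv_nonpos (convex_Icc _ _) W.γ_smooth.continuousOn ?_ fun t ht => ?_
      · exact (W.γ_smooth.differentiableOn (by norm_num)).mono interior_subset
      · rw [interior_Icc] at ht
        rw [(W.hasDerivAt_γ ht).deriv]
        exact h1 t (Ioo_subset_Icc_self ht)
    have hγψ := (hanti (left_mem_Icc.2 W.m_pos.le) hψ hψ.1).trans_lt hγ
    rw [← hpσ, div_lt_one k2]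
    linarith [mul_pos_of_neg_of_neg hγψ (W.u_neg (x := p.1) (y := p.2) hpm)]
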